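/- arXiv:2011.05535 — 2 statements merged into one kernel-verified Lean document; each statement's English description precedes it below -/
import Mathlib

section
/- Let E be a field of characteristic different from 2 such that every 3-dimensional regular quadratic form over E is isotropic. Let f ∈ E[X] be square-reflexive. Then every 4-dimensional regular quadratic form φ over E(X) whose determinant lies in f·(E(X)^×)² and which is isotropic over the completion E(X)_v for every v ∈ Ω_{E(X)/E} is isotropic over E(X). -/
open Polynomial

/-- `f` is square-reflexive over `E`. -/
def IsSquareReflexive {E : Type*} [Field E] (f : Polynomial E) : Prop :=
  Squarefree f ∧
  ∀ α : (Polynomial E ⧸ Ideal.span {f})ˣ,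
    (∃ u : Eˣ, Algebra.norm E (α : Polynomial E ⧸ Ideal.span {f}) = (u : E) ^ 2 ∨
               Algebra.norm E (α : Polynomial E ⧸ Ideal.span {f}) = f.leadingCoeff * (u : E) ^ 2) →
    ∃ g : Polynomial E, IsCoprime f g ∧
      (∃ β : (Polynomial E ⧸ Ideal.span {f})ˣ,
        Ideal.Quotient.mk (Ideal.span {f}) g
          = (α : Polynomial E ⧸ Ideal.span {f}) * (β : Polynomial E ⧸ Ideal.span {f}) ^ 2) ∧
      IsSquare (Ideal.Quotient.mk (Ideal.span {g}) f)

/-- Isotropy of the diagonal quadratic form `⟨a 0, …, a (n-1)⟩`. -/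
def IsotropicDiag {R : Type*} [CommRing R] {n : ℕ} (a : Fin n → R) : Prop :=
  ∃ x : Fin n → R, x ≠ 0 ∧ ∑ i, a i * x i ^ 2 = 0

/-- `v` is a ℤ-valuation on `E(X)` (i.e. a valuation with value group exactly ℤ)
which is trivial on `E`. -/
def IsZValuationTrivialOnBase (E : Type*) [Field E]
    (v : Valuation (RatFunc E) (WithZero (Multiplicative ℤ))) : Prop :=
  Function.Surjective v ∧ ∀ a : Eˣ, v (algebraMap E (RatFunc E) a) = 1

/-- The diagonal form `⟨a 0, …, a (n-1)⟩` is isotropic over the completion of `F`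
at the ℤ-valuation `v`. -/
noncomputable def IsotropicCompletion {F : Type*} [Field F]
    (v : Valuation F (WithZero (Multiplicative ℤ))) {n : ℕ} (a : Fin n → F) : Prop :=
  letI : Valued F (WithZero (Multiplicative ℤ)) := Valued.mk' v
  IsotropicDiag (fun i => UniformSpace.Completion.coe' (α := F) (a i))

/-- The group of square classes of a field, written additively. -/
def SqCl (k : Type*) [Field k] : Type _ :=
  Additive (kˣ ⧸ (powMonoidHom 2 : kˣ →* kˣ).range)

noncomputable instance (k : Type*) [Field k] : AddCommGroup (SqCl k) :=
  inferInstanceAs (AddCommGroup (Additive (kˣ ⧸ (powMonoidHom 2 : kˣ →* kˣ).range)))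

/-- The square class of a unit. -/
def SqCl.mk {k : Type*} [Field k] : Additive kˣ →+ SqCl k :=
  MonoidHom.toAdditive (QuotientGroup.mk' (powMonoidHom 2 : kˣ →* kˣ).range)

/-- The square class of a field element, with junk value `0` at `0`. -/
noncomputable def sqCl {k : Type*} [Field k] (u : k) : SqCl k :=
  open Classical in
  if h : u = 0 then 0 else SqCl.mk (Additive.ofMul (Units.mk0 u h))

section SqCl
variable {k : Type*} [Field k]

lemma SqCl.mk_surjective : Function.Surjective (SqCl.mk (k := k)) :=
  QuotientGroup.mk_surjective (s := (powMonoidHom 2 : kˣ →* kˣ).range)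

lemma SqCl.mk_eq_zero_iff (u : kˣ) : SqCl.mk (Additive.ofMul u) = 0 ↔ IsSquare (u : k) := by
  refine (QuotientGroup.eq_one_iff (N := (powMonoidHom 2 : kˣ →* kˣ).range) u).trans ?_
  constructor
  · rintro ⟨x, hx⟩
    refine ⟨x, ?_⟩
    have := congrArg Units.val hx
    simpa [pow_two] using this.symm
  · rintro ⟨x, hx⟩
    have hx0 : x ≠ 0 := by rintro rfl; simp at hx
    refine ⟨Units.mk0 x hx0, ?_⟩
    ext; simp [pow_two, hx]

lemma sqCl_of_ne {u : k} (h : u ≠ 0) :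
    sqCl u = SqCl.mk (Additive.ofMul (Units.mk0 u h)) := by
  rw [sqCl, dif_neg h]

lemma sqCl_mul {u w : k} (hu : u ≠ 0) (hw : w ≠ 0) : sqCl (u * w) = sqCl u + sqCl w := by
  rw [sqCl_of_ne hu, sqCl_of_ne hw, sqCl_of_ne (mul_ne_zero hu hw), ← map_add, ← ofMul_mul]
  congr 2
  ext; simp

lemma sqCl_eq_zero_iff {u : k} (hu : u ≠ 0) : sqCl u = 0 ↔ IsSquare u := by
  rw [sqCl_of_ne hu, SqCl.mk_eq_zero_iff, Units.val_mk0]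

lemma sqCl_sq {u : k} : sqCl (u ^ 2) = 0 := by
  by_cases hu : u = 0
  · simp [hu, sqCl]
  · exact (sqCl_eq_zero_iff (pow_ne_zero _ hu)).2 (IsSquare.sq u)

lemma sqCl_one : sqCl (1 : k) = 0 := by simpa using sqCl_sq (u := (1 : k))

lemma exists_sqCl_eq (x : SqCl k) : ∃ u : k, u ≠ 0 ∧ sqCl u = x := by
  obtain ⟨u, rfl⟩ := SqCl.mk_surjective x
  refine ⟨(Additive.toMul u : kˣ), Units.ne_zero _, ?_⟩
  rw [sqCl_of_ne (Units.ne_zero _)]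
  simp

lemma SqCl.add_self (x : SqCl k) : x + x = 0 := by
  obtain ⟨u, hu, rfl⟩ := exists_sqCl_eq x
  rw [← sqCl_mul hu hu, ← pow_two, sqCl_sq]

lemma SqCl.zsmul_even (x : SqCl k) {n : ℤ} (hn : Even n) : n • x = 0 := by
  obtain ⟨m, rfl⟩ := hn
  rw [add_smul, ← smul_add, SqCl.add_self, smul_zero]

lemma SqCl.zsmul_odd (x : SqCl k) {n : ℤ} (hn : Odd n) : n • x = x := by
  obtain ⟨m, rfl⟩ := hn
  rw [add_smul, SqCl.zsmul_even x (even_two_mul m), one_smul, zero_add]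

lemma SqCl.zsmul_eq_or (x : SqCl k) (n : ℤ) : n • x = 0 ∨ n • x = x := by
  rcases Int.even_or_odd n with h | h
  · exact Or.inl (x.zsmul_even h)
  · exact Or.inr (x.zsmul_odd h)

lemma SqCl.eq_of_add_eq_zero {x y : SqCl k} (h : x + y = 0) : x = y := by
  have := y.add_self
  exact add_right_cancel (h.trans this.symm)

lemma sqCl_eq_iff {u w : k} (hu : u ≠ 0) (hw : w ≠ 0) : sqCl u = sqCl w ↔ IsSquare (u * w) := by
  rw [← sqCl_eq_zero_iff (mul_ne_zero hu hw), sqCl_mul hu hw]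
  exact ⟨fun h => by rw [h, SqCl.add_self], SqCl.eq_of_add_eq_zero⟩

lemma sqCl_pow {u : k} (hu : u ≠ 0) (n : ℕ) : sqCl (u ^ n) = n • sqCl u := by
  induction n with
  | zero => simp [sqCl_one]
  | succ n ih => rw [pow_succ, sqCl_mul (pow_ne_zero _ hu) hu, ih, succ_nsmul]

end SqCl

/-- A bimultiplicative map on the nonzero elements of `R` that vanishes on the pairs `(a, b)`
with `b` represented by the norm form `X ^ 2 - a Y ^ 2`. -/
structure QuadSymbol (R A : Type*) [CommRing R] [AddCommGroup A] where
  toFun : R → R → A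
  mul_left' : ∀ a b c : R, a ≠ 0 → b ≠ 0 → c ≠ 0 → toFun (a * b) c = toFun a c + toFun b c
  mul_right' : ∀ a b c : R, a ≠ 0 → b ≠ 0 → c ≠ 0 → toFun a (b * c) = toFun a b + toFun a c
  norm' : ∀ a x y : R, a ≠ 0 → x ^ 2 - a * y ^ 2 ≠ 0 → toFun a (x ^ 2 - a * y ^ 2) = 0

namespace QuadSymbol

instance {R A : Type*} [CommRing R] [AddCommGroup A] :
    CoeFun (QuadSymbol R A) (fun _ => R → R → A) := ⟨QuadSymbol.toFun⟩

variable {R A : Type*} [CommRing R] [AddCommGroup A] (s : QuadSymbol R A) {a b c d : R}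

lemma mul_left (ha : a ≠ 0) (hb : b ≠ 0) (hc : c ≠ 0) : s (a * b) c = s a c + s b c :=
  s.mul_left' a b c ha hb hc

lemma mul_right (ha : a ≠ 0) (hb : b ≠ 0) (hc : c ≠ 0) : s a (b * c) = s a b + s a c :=
  s.mul_right' a b c ha hb hc

lemma norm_eq {x y : R} (ha : a ≠ 0) (hb : b ≠ 0) (h : b = x ^ 2 - a * y ^ 2) : s a b = 0 := by
  subst h; exact s.norm' a x y ha hb

lemma neg_self_right (ha : a ≠ 0) : s a (-a) = 0 :=
  s.norm_eq (x := 0) (y := 1) ha (neg_ne_zero.2 ha) (by ring)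

variable [IsDomain R]

lemma add_self (ha : a ≠ 0) (hb : b ≠ 0) : s a b + s a b = 0 := by
  rw [← s.mul_right ha hb hb]
  exact s.norm_eq (x := b) (y := 0) ha (mul_ne_zero hb hb) (by ring)

lemma sq_right (ha : a ≠ 0) (hb : b ≠ 0) : s a (b ^ 2) = 0 := by
  rw [pow_two, s.mul_right ha hb hb, s.add_self ha hb]

lemma symm (ha : a ≠ 0) (hb : b ≠ 0) : s a b = s b a := by
  have hab := mul_ne_zero ha hb
  have h := s.neg_self_right hab
  have h1 : s a (-(a * b)) = s a (-a) + s a b := by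
    rw [← s.mul_right ha (neg_ne_zero.2 ha) hb]; ring_nf
  have h2 : s b (-(a * b)) = s b (-b) + s b a := by
    rw [← s.mul_right hb (neg_ne_zero.2 hb) ha]; ring_nf
  rw [s.mul_left ha hb (neg_ne_zero.2 hab), h1, h2, s.neg_self_right ha,
    s.neg_self_right hb, zero_add, zero_add] at h
  exact add_right_cancel (h.trans (s.add_self hb ha).symm)

lemma sq_left (ha : a ≠ 0) (hb : b ≠ 0) : s (a ^ 2) b = 0 := by
  rw [s.symm (pow_ne_zero _ ha) hb, s.sq_right hb ha]

lemma self_eq (ha : a ≠ 0) : s a a = s a (-1) := by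
  have h := s.neg_self_right ha
  have : s a (-a) = s a (-1) + s a a := by
    rw [← s.mul_right ha (neg_ne_zero.2 one_ne_zero) ha]; ring_nf
  rw [this] at h
  have h1 := s.add_self ha (b := -1) (neg_ne_zero.2 one_ne_zero)
  exact add_left_cancel (h.trans h1.symm)

lemma one_right (ha : a ≠ 0) : s a 1 = 0 := by simpa using s.sq_right ha one_ne_zero

lemma eq_of_add_eq_zero (ha : a ≠ 0) (hb : b ≠ 0) {x : A} (h : x + s a b = 0) : x = s a b :=
  add_right_cancel (h.trans (s.add_self ha hb).symm)

/-- The Steinberg relation for `u = w + v`. -/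
lemma steinberg {u w v : R} (hu : u ≠ 0) (hw : w ≠ 0) (hv : v ≠ 0) (h : u = w + v) :
    s (w * u) (v * u) = 0 :=
  s.norm_eq (x := u) (y := 1) (mul_ne_zero hw hu) (mul_ne_zero hv hu) (by rw [h]; ring)

/-- An isotropic four-dimensional form of determinant `f` has a symbol of the form `(f, t)`. -/
lemma exists_eq_of_isotropic {a b f x₀ x₁ x₂ x₃ : R} (ha : a ≠ 0) (hb : b ≠ 0) (hf : f ≠ 0)
    (h : x₀ ^ 2 - a * x₁ ^ 2 - b * x₂ ^ 2 + a * b * f * x₃ ^ 2 = 0)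
    (hne : x₀ ≠ 0 ∨ x₁ ≠ 0 ∨ x₂ ≠ 0 ∨ x₃ ≠ 0) : ∃ t, t ≠ 0 ∧ s a b = s f t := by
  have haf := mul_ne_zero ha hf
  have key : x₀ ^ 2 - a * x₁ ^ 2 = b * (x₂ ^ 2 - a * f * x₃ ^ 2) := by linear_combination h
  have split : ∀ {c y z : R}, c ≠ 0 → y ^ 2 - c * z ^ 2 = 0 → (y ≠ 0 ∨ z ≠ 0) →
      ∀ d, d ≠ 0 → s c d = 0 := by
    intro c y z hc h0 hyz d hd
    have hz : z ≠ 0 := by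
      rintro rfl
      have : y = 0 := by simpa using h0
      tauto
    have h1 : s (c * z ^ 2) d = s c d := by
      rw [s.mul_left hc (pow_ne_zero _ hz) hd, s.sq_left hz hd, add_zero]
    have hcz : c * z ^ 2 = y ^ 2 := by linear_combination -h0
    have hy : y ≠ 0 := by
      rintro rfl
      have := mul_ne_zero hc (pow_ne_zero 2 hz)
      rw [hcz] at this; simp at this
    rw [← h1, hcz, s.sq_left hy hd]
  by_cases ht : x₀ ^ 2 - a * x₁ ^ 2 = 0
  · by_cases h01 : x₀ ≠ 0 ∨ x₁ ≠ 0
    · exact ⟨1, one_ne_zero, by rw [split ha ht h01 b hb, s.one_right hf]⟩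
    · refine ⟨b, hb, ?_⟩
      have h0 := split haf ((mul_eq_zero.1 (key.symm.trans ht)).resolve_left hb)
        (by tauto) b hb
      rw [s.mul_left ha hf hb] at h0
      exact s.eq_of_add_eq_zero hf hb h0
  · have hw : x₂ ^ 2 - a * f * x₃ ^ 2 ≠ 0 := fun h0 => ht (by rw [key, h0, mul_zero])
    refine ⟨_, hw, ?_⟩
    have h1 := s.norm' a x₀ x₁ ha ht
    rw [key, s.mul_right ha hb hw] at h1
    have h2 := s.norm' (a * f) x₂ x₃ haf hw
    rw [s.mul_left ha hf hw] at h2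
    rw [s.eq_of_add_eq_zero ha hw h1, s.eq_of_add_eq_zero hf hw h2]

/-- The composite of a symbol with an injective ring homomorphism. -/
def comap {S : Type*} [CommRing S] (φ : S →+* R) (hφ : Function.Injective φ) :
    QuadSymbol S A where
  toFun x y := s (φ x) (φ y)
  mul_left' x y z hx hy hz := by
    have h : ∀ w, w ≠ 0 → φ w ≠ 0 := fun w => (map_ne_zero_iff φ hφ).2
    rw [map_mul, s.mul_left (h x hx) (h y hy) (h z hz)]
  mul_right' x y z hx hy hz := by
    have h : ∀ w, w ≠ 0 → φ w ≠ 0 := fun w => (map_ne_zero_iff φ hφ).2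
    rw [map_mul, s.mul_right (h x hx) (h y hy) (h z hz)]
  norm' x y z hx hy := by
    have h : ∀ w, w ≠ 0 → φ w ≠ 0 := fun w => (map_ne_zero_iff φ hφ).2
    exact s.norm_eq (x := φ y) (y := φ z) (h x hx) (h _ hy) (by simp)

end QuadSymbol

/-- A discrete valuation on a domain together with a multiplicative angular component with
values in the residue field. -/
structure AngularData (R k : Type*) [CommRing R] [Field k] where
  v : R → ℤ
  ac : R → k
  v_mul : ∀ {a b}, a ≠ 0 → b ≠ 0 → v (a * b) = v a + v b
  ac_mul : ∀ {a b}, a ≠ 0 → b ≠ 0 → ac (a * b) = ac a * ac b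
  ac_ne_zero : ∀ {a}, a ≠ 0 → ac a ≠ 0
  v_neg : ∀ a, v (-a) = v a
  ac_neg : ∀ a, ac (-a) = -ac a
  add_of_lt : ∀ {a b}, a ≠ 0 → b ≠ 0 → v a < v b → v (a + b) = v a ∧ ac (a + b) = ac a
  add_of_eq : ∀ {a b}, a ≠ 0 → b ≠ 0 → v a = v b → ac a + ac b ≠ 0 → v (a + b) = v a

namespace AngularData

variable {R k : Type*} [CommRing R] [Field k] (D : AngularData R k)

/-- The tame symbol modulo squares. -/
noncomputable def tame (a b : R) : SqCl k :=
  (D.v a * D.v b) • sqCl (-1) + D.v b • sqCl (D.ac a) + D.v a • sqCl (D.ac b)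

lemma v_sq {a : R} (ha : a ≠ 0) : D.v (a ^ 2) = 2 * D.v a := by
  rw [pow_two, D.v_mul ha ha]; ring

lemma ac_sq {a : R} (ha : a ≠ 0) : D.ac (a ^ 2) = D.ac a ^ 2 := by
  rw [pow_two, D.ac_mul ha ha]; ring

lemma tame_congr {a b b' : R} (hv : D.v b = D.v b') (hac : D.ac b = D.ac b') :
    D.tame a b = D.tame a b' := by
  rw [tame, tame, hv, hac]

lemma tame_congr_left {a a' b : R} (hv : D.v a = D.v a') (hac : D.ac a = D.ac a') :
    D.tame a b = D.tame a' b := by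
  rw [tame, tame, hv, hac]

lemma tame_mul_right {a b c : R} (hb : b ≠ 0) (hc : c ≠ 0) :
    D.tame a (b * c) = D.tame a b + D.tame a c := by
  simp only [tame, D.v_mul hb hc, D.ac_mul hb hc, sqCl_mul (D.ac_ne_zero hb) (D.ac_ne_zero hc)]
  module

lemma tame_symm (a b : R) : D.tame a b = D.tame b a := by
  simp only [tame, mul_comm (D.v a)]
  abel

lemma tame_sq {a b : R} (hb : b ≠ 0) : D.tame a (b ^ 2) = 0 := by
  rw [pow_two, D.tame_mul_right hb hb, SqCl.add_self]

lemma tame_neg_self {a : R} (ha : a ≠ 0) : D.tame a (-a) = 0 := by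
  have h1 : (-1 : k) ≠ 0 := neg_ne_zero.2 one_ne_zero
  have : sqCl (-D.ac a) = sqCl (-1) + sqCl (D.ac a) := by
    rw [← sqCl_mul h1 (D.ac_ne_zero ha), neg_one_mul]
  have h2 : Even (D.v a * D.v a + D.v a) := by
    have := Int.even_mul_succ_self (D.v a)
    rwa [mul_add, mul_one] at this
  have h3 := (sqCl (-1 : k)).zsmul_even h2
  have h4 := (D.v a • sqCl (D.ac a)).add_self
  simp only [tame, D.v_neg, D.ac_neg, this, smul_add]
  rw [add_smul] at h3
  linear_combination (norm := module) h3 + h4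

lemma tame_of_even {a b : R} (ha : Even (D.v a)) : D.tame a b = D.v b • sqCl (D.ac a) := by
  rw [tame, SqCl.zsmul_even _ (ha.mul_right _), SqCl.zsmul_even _ ha]
  simp

variable [IsDomain R]

/-- The tame symbol as a `QuadSymbol`. -/
noncomputable def tameSymbol : QuadSymbol R (SqCl k) where
  toFun := D.tame
  mul_left' a b c ha hb _ := by
    rw [D.tame_symm, D.tame_mul_right ha hb, D.tame_symm c, D.tame_symm c]
  mul_right' a b c _ hb hc := D.tame_mul_right hb hc
  norm' a x y ha hne := by
    by_cases hy : y = 0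
    · subst hy
      have hx : x ≠ 0 := by rintro rfl; simp at hne
      simpa using D.tame_sq (a := a) hx
    have hay : -a * y ^ 2 ≠ 0 := mul_ne_zero (neg_ne_zero.2 ha) (pow_ne_zero _ hy)
    have h0 : D.tame a (-a * y ^ 2) = 0 := by
      rw [D.tame_mul_right (neg_ne_zero.2 ha) (pow_ne_zero _ hy), D.tame_neg_self ha,
        D.tame_sq hy, add_zero]
    by_cases hx : x = 0
    · subst hx
      simpa using h0
    have hx2 := pow_ne_zero 2 hx
    have hs : x ^ 2 - a * y ^ 2 = x ^ 2 + -a * y ^ 2 := by ring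
    rw [hs] at hne ⊢
    have hvay : D.v (-a * y ^ 2) = D.v a + 2 * D.v y := by
      rw [D.v_mul (neg_ne_zero.2 ha) (pow_ne_zero _ hy), D.v_neg, D.v_sq hy]
    have hacay : D.ac (-a * y ^ 2) = - D.ac a * D.ac y ^ 2 := by
      rw [D.ac_mul (neg_ne_zero.2 ha) (pow_ne_zero _ hy), D.ac_neg, D.ac_sq hy]
    rcases lt_trichotomy (D.v (x ^ 2)) (D.v (-a * y ^ 2)) with h | h | h
    · obtain ⟨h1, h2⟩ := D.add_of_lt hx2 hay h
      rw [D.tame_congr h1 h2, D.tame_sq hx]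
    · have hev : Even (D.v a) := ⟨D.v x - D.v y, by
        rw [hvay, D.v_sq hx] at h; linarith⟩
      rw [D.tame_of_even hev]
      by_cases hsum : D.ac (x ^ 2) + D.ac (-a * y ^ 2) = 0
      · have hsq : IsSquare (D.ac a) := by
          refine ⟨D.ac x / D.ac y, ?_⟩
          rw [D.ac_sq hx, hacay] at hsum
          have := D.ac_ne_zero hy
          field_simp
          linear_combination -hsum
        rw [(sqCl_eq_zero_iff (D.ac_ne_zero ha)).2 hsq, smul_zero]
      · rw [D.add_of_eq hx2 hay h hsum]
        exact SqCl.zsmul_even _ ⟨D.v x, by rw [D.v_sq hx]; ring⟩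
    · obtain ⟨h1, h2⟩ := D.add_of_lt hay hx2 h
      rw [add_comm, D.tame_congr h1 h2, h0]

end AngularData

section GaloisSymbol

variable (F : Type*) [Field F]

/-- The absolute Galois group of `F`. -/
local notation "Γ" => SeparableClosure F ≃ₐ[F] SeparableClosure F
local notation "Lₛ" => SeparableClosure F

/-- Two-cochains that are coboundaries of one-cochains factoring through a finite level. -/
def finiteCoboundaries : Subgroup (Γ → Γ → Lₛˣ) where
  carrier := {c | ∃ (γ : Γ → Lₛ) (S : Finset Lₛ), (∀ σ, γ σ ≠ 0) ∧
    (∀ σ σ' : Γ, (∀ x ∈ S, σ x = σ' x) → γ σ = γ σ') ∧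
    ∀ σ τ, (c σ τ : Lₛ) * γ (σ * τ) = γ σ * σ (γ τ)}
  one_mem' := ⟨1, ∅, by simp, by simp, by simp⟩
  mul_mem' := by
    classical
    rintro c d ⟨γ, S, h0, hS, h⟩ ⟨δ, T, k0, hT, k⟩
    refine ⟨γ * δ, S ∪ T, fun σ => mul_ne_zero (h0 σ) (k0 σ), fun σ σ' hx => ?_,
      fun σ τ => ?_⟩
    · rw [Pi.mul_apply, Pi.mul_apply, hS σ σ' fun x hxS => hx x (Finset.mem_union_left _ hxS),
        hT σ σ' fun x hxT => hx x (Finset.mem_union_right _ hxT)]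
    · simp only [Pi.mul_apply, Units.val_mul, map_mul]
      linear_combination (d σ τ : Lₛ) * δ (σ * τ) * h σ τ + γ σ * σ (γ τ) * k σ τ
  inv_mem' := by
    rintro c ⟨γ, S, h0, hS, h⟩
    refine ⟨γ⁻¹, S, fun σ => inv_ne_zero (h0 σ), fun σ σ' hx => ?_, fun σ τ => ?_⟩
    · rw [Pi.inv_apply, Pi.inv_apply, hS σ σ' hx]
    · simp only [Pi.inv_apply, Units.val_inv_eq_inv_val, map_inv₀]
      rw [← mul_inv, ← mul_inv, h σ τ]

variable {F}

/-- A chosen square root in the separable closure. -/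
noncomputable def sepSqrt (a : F) : Lₛ :=
  open Classical in
  if h : ∃ z : Lₛ, z ^ 2 = algebraMap F Lₛ a then h.choose else 0

/-- The sign by which an automorphism acts on the chosen square root of `a`. -/
noncomputable def sqrtSign (a : F) (σ : Γ) : Lₛˣ :=
  open Classical in if σ (sepSqrt a) = sepSqrt a then 1 else -1

/-- The cup product of the quadratic characters attached to `a` and `b`. -/
noncomputable def cupCochain (a b : F) (σ τ : Γ) : Lₛˣ :=
  open Classical in if sqrtSign a τ = 1 then 1 else sqrtSign b σ

lemma two_ne_zero_sep (h2 : (2 : F) ≠ 0) : (2 : Lₛ) ≠ 0 := by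
  have := (_root_.map_ne_zero (algebraMap F Lₛ)).2 h2
  rwa [map_ofNat] at this

lemma sepSqrt_sq (h2 : (2 : F) ≠ 0) (a : F) : sepSqrt a ^ 2 = algebraMap F Lₛ a := by
  have : NeZero ((2 : ℕ) : Lₛ) := ⟨by simpa using two_ne_zero_sep h2⟩
  have h := IsSepClosed.exists_pow_nat_eq (algebraMap F Lₛ a) 2
  rw [sepSqrt, dif_pos h]
  exact h.choose_spec

lemma sepSqrt_ne_zero (h2 : (2 : F) ≠ 0) {a : F} (ha : a ≠ 0) : (sepSqrt a : Lₛ) ≠ 0 := by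
  intro h
  have := sepSqrt_sq h2 a
  rw [h, zero_pow two_ne_zero] at this
  exact ha ((map_eq_zero _).1 this.symm)

lemma one_ne_neg_one_sep (h2 : (2 : F) ≠ 0) : (1 : Lₛˣ) ≠ -1 := by
  intro h
  have := congrArg Units.val h
  simp only [Units.val_one, Units.val_neg] at this
  exact two_ne_zero_sep h2 (by linear_combination this)

lemma sqrtSign_eq_or (a : F) (σ : Γ) : sqrtSign a σ = 1 ∨ sqrtSign a σ = -1 := by
  unfold sqrtSign; split_ifs <;> simp

lemma sqrtSign_mul_self (a : F) (σ : Γ) : sqrtSign a σ * sqrtSign a σ = 1 := by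
  rcases sqrtSign_eq_or a σ with h | h <;> simp [h]

lemma map_sqrtSign (a : F) (σ τ : Γ) : τ (sqrtSign a σ : Lₛ) = sqrtSign a σ := by
  rcases sqrtSign_eq_or a σ with h | h <;> simp [h]

lemma apply_sepSqrt (h2 : (2 : F) ≠ 0) (a : F) (σ : Γ) :
    σ (sepSqrt a) = sqrtSign a σ * sepSqrt a := by
  unfold sqrtSign
  split_ifs with h
  · simpa using h
  · have h1 : σ (sepSqrt a) ^ 2 = sepSqrt a ^ 2 := by
      rw [← map_pow, sepSqrt_sq h2]; simp
    rcases sq_eq_sq_iff_eq_or_eq_neg.1 h1 with h3 | h3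
    · exact absurd h3 h
    · simpa using h3

lemma sqrtSign_eq_of_apply (h2 : (2 : F) ≠ 0) {a : F} {σ : Γ} (ha : a ≠ 0) {z : Lₛ} {e : Lₛˣ}
    (hz : z ^ 2 = algebraMap F Lₛ a) (h : σ z = e * z) : sqrtSign a σ = e := by
  have h1 : z ^ 2 = sepSqrt a ^ 2 := by rw [hz, sepSqrt_sq h2]
  have h0 := sepSqrt_ne_zero h2 ha
  have h3 := apply_sepSqrt h2 a σ
  refine Units.ext (mul_right_cancel₀ h0 ?_)
  rw [← h3]
  rcases sq_eq_sq_iff_eq_or_eq_neg.1 h1 with h4 | h4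
  · rwa [h4] at h
  · rw [h4] at h; simpa using h

lemma sqrtSign_mul (h2 : (2 : F) ≠ 0) {a b : F} (ha : a ≠ 0) (hb : b ≠ 0) (σ : Γ) :
    sqrtSign (a * b) σ = sqrtSign a σ * sqrtSign b σ := by
  refine sqrtSign_eq_of_apply h2 (mul_ne_zero ha hb) (z := sepSqrt a * sepSqrt b) ?_ ?_
  · rw [mul_pow, sepSqrt_sq h2, sepSqrt_sq h2, map_mul]
  · rw [map_mul, apply_sepSqrt h2, apply_sepSqrt h2, Units.val_mul]; ring

lemma sqrtSign_comp (h2 : (2 : F) ≠ 0) {a : F} (ha : a ≠ 0) (σ τ : Γ) :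
    sqrtSign a (σ * τ) = sqrtSign a σ * sqrtSign a τ := by
  refine sqrtSign_eq_of_apply h2 ha (sepSqrt_sq h2 a) ?_
  rw [AlgEquiv.mul_apply, apply_sepSqrt h2, map_mul, map_sqrtSign, apply_sepSqrt h2, Units.val_mul]
  ring

lemma cupCochain_norm (h2 : (2 : F) ≠ 0) {a b x y : F} (ha : a ≠ 0) (hb : b ≠ 0)
    (h : b = x ^ 2 - a * y ^ 2) :
    cupCochain a b ∈ finiteCoboundaries F := by
  classical
  set α := (sepSqrt a : Lₛ) with hα
  set β := (sepSqrt b : Lₛ) with hβ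
  have hα2 : α ^ 2 = algebraMap F Lₛ a := sepSqrt_sq h2 a
  have hβ2 : β ^ 2 = algebraMap F Lₛ b := sepSqrt_sq h2 b
  have hβ0 : β ≠ 0 := sepSqrt_ne_zero h2 hb
  set X := algebraMap F Lₛ x
  set Y := algebraMap F Lₛ y
  have hbz : (X + Y * α) * (X - Y * α) = β ^ 2 := by
    rw [hβ2, h]; simp only [map_sub, map_mul, map_pow]; rw [← hα2]; ring
  have hz0 : X + Y * α ≠ 0 := by
    intro h0; rw [h0, zero_mul] at hbz; exact pow_ne_zero 2 hβ0 hbz.symm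
  have hz0' : X - Y * α ≠ 0 := by
    intro h0; rw [h0, mul_zero] at hbz; exact pow_ne_zero 2 hβ0 hbz.symm
  have hne := one_ne_neg_one_sep (F := F) h2
  refine ⟨fun σ => if sqrtSign a σ = 1 then 1 else β / (X + Y * α), {α}, fun σ => ?_, ?_, ?_⟩
  · dsimp only; split_ifs
    · exact one_ne_zero
    · exact div_ne_zero hβ0 hz0
  · intro σ σ' hx
    have : sqrtSign a σ = sqrtSign a σ' := by
      have := hx α (by simp)
      simp only [sqrtSign, ← hα, this]
    simp only [this]
  · intro σ τ
    have hσα : σ α = sqrtSign a σ * α := apply_sepSqrt h2 a σ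
    have hσβ : σ β = sqrtSign b σ * β := apply_sepSqrt h2 b σ
    have hX : σ X = X := σ.commutes x
    have hY : σ Y = Y := σ.commutes y
    simp only [cupCochain, sqrtSign_comp h2 ha]
    rcases sqrtSign_eq_or a τ with hτ | hτ
    · simp [hτ]
    · rcases sqrtSign_eq_or a σ with hσ | hσ
      · simp only [hτ, hσ, hne.symm, if_false, if_true, one_mul, map_div₀, map_add, map_mul,
          hσα, hσβ, hX, hY, Units.val_one]
        rw [mul_div_assoc]
      · simp only [hτ, hσ, hne.symm, if_false, if_true, neg_mul_neg, one_mul, map_div₀, map_add,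
          map_mul, hσα, hσβ, hX, hY, Units.val_one, Units.val_neg]
        rw [neg_mul, one_mul, mul_neg, ← sub_eq_add_neg]
        field_simp
        linear_combination hbz

/-- The symbol `(a, b)` in the cochain model of the Brauer group. -/
noncomputable def galoisSymbol (h2 : (2 : F) ≠ 0) :
    QuadSymbol F (Additive ((Γ → Γ → Lₛˣ) ⧸ finiteCoboundaries F)) where
  toFun a b := Additive.ofMul (QuotientGroup.mk (cupCochain a b))
  mul_left' a b c ha hb hc := by
    rw [← ofMul_mul, ← QuotientGroup.mk_mul]
    congr 2
    funext σ τ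
    have hne := one_ne_neg_one_sep (F := F) h2
    have := sqrtSign_mul_self c σ
    have hab := sqrtSign_mul h2 ha hb τ
    simp only [cupCochain, Pi.mul_apply]
    rcases sqrtSign_eq_or a τ with h | h <;> rcases sqrtSign_eq_or b τ with h' | h' <;>
      rw [h, h'] at hab <;> simp [h, h', hab, hne.symm, this]
  mul_right' a b c ha hb hc := by
    rw [← ofMul_mul, ← QuotientGroup.mk_mul]
    congr 2
    funext σ τ
    simp only [cupCochain, Pi.mul_apply, sqrtSign_mul h2 hb hc]
    split_ifs <;> simp
  norm' a x y ha hne := by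
    rw [ofMul_eq_zero, QuotientGroup.eq_one_iff]
    exact cupCochain_norm h2 ha hne rfl

/-- Hilbert's Theorem 90 for a cocycle on a subgroup that factors through a finite level. -/
lemma exists_ne_zero_twisted_fixed (N : Subgroup Γ) (γ : Γ → Lₛ) (S : Finset Lₛ)
    (h0 : ∀ σ, γ σ ≠ 0) (hS : ∀ σ σ' : Γ, (∀ x ∈ S, σ x = σ' x) → γ σ = γ σ')
    (hN : ∀ σ ∈ N, ∀ τ ∈ N, γ (σ * τ) = γ σ * σ (γ τ)) :
    ∃ t, t ≠ 0 ∧ ∀ σ ∈ N, γ σ * σ t = t := by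
  classical
  let M := IntermediateField.adjoin F (S : Set Lₛ)
  have hfin : FiniteDimensional F M := by
    refine IntermediateField.finiteDimensional_adjoin fun x _ => ?_
    exact Algebra.IsIntegral.isIntegral x
  let r : Γ → (M →ₐ[F] Lₛ) := fun σ => (σ : Lₛ →ₐ[F] Lₛ).comp M.val
  have hr : ∀ σ (x : M), r σ x = σ x := fun σ x => rfl
  have hγ : ∀ σ σ', r σ = r σ' → γ σ = γ σ' := fun σ σ' h => hS σ σ' fun x hx =>
    DFunLike.congr_fun h (⟨x, IntermediateField.subset_adjoin F _ hx⟩ : M)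
  have : Finite (M →ₐ[F] Lₛ) := inferInstance
  have : Fintype (M →ₐ[F] Lₛ) := Fintype.ofFinite _
  let H : Set (M →ₐ[F] Lₛ) := r '' N
  have hH : ∀ h : H, ∃ σ ∈ N, r σ = h := fun h => h.2
  choose s hsN hs using hH
  let i1 : H := ⟨r 1, 1, N.one_mem, rfl⟩
  have hlin : LinearIndependent Lₛ (fun h : H => ((h : M →ₐ[F] Lₛ) : M → Lₛ)) := by
    have h1 := linearIndependent_monoidHom M Lₛ
    have hinj : Function.Injective
        (fun h : H => ((h : M →ₐ[F] Lₛ) : M →* Lₛ)) := by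
      intro h h' hh
      apply Subtype.ext
      exact AlgHom.ext fun x => DFunLike.congr_fun hh x
    exact h1.comp _ hinj
  have hsum : ∑ h : H, γ (s h) • ((h : M →ₐ[F] Lₛ) : M → Lₛ) ≠ 0 := fun hz =>
    h0 _ (Fintype.linearIndependent_iff.1 hlin (fun h => γ (s h)) hz i1)
  obtain ⟨x, hx⟩ := Function.ne_iff.1 hsum
  simp only [Finset.sum_apply, Pi.smul_apply, smul_eq_mul, Pi.zero_apply] at hx
  refine ⟨_, hx, fun σ hσ => ?_⟩
  have hmem : ∀ (ρ : Γ), ρ ∈ N → ∀ h : H, r (ρ * s h) ∈ H :=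
    fun ρ hρ h => ⟨_, N.mul_mem hρ (hsN h), rfl⟩
  have hcomp : ∀ (ρ σ σ' : Γ), r σ = r σ' → r (ρ * σ) = r (ρ * σ') := by
    intro ρ σ σ' h
    ext x
    have := DFunLike.congr_fun h x
    simp only [hr, AlgEquiv.mul_apply] at this ⊢
    rw [this]
  let e : H ≃ H :=
    { toFun := fun h => ⟨r (σ * s h), hmem σ hσ h⟩
      invFun := fun h => ⟨r (σ⁻¹ * s h), hmem _ (N.inv_mem hσ) h⟩
      left_inv := fun h => by
        apply Subtype.ext
        rw [← hs h]
        have := hcomp σ⁻¹ _ _ (hs ⟨r (σ * s h), hmem σ hσ h⟩)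
        simpa using this
      right_inv := fun h => by
        apply Subtype.ext
        rw [← hs h]
        have := hcomp σ _ _ (hs ⟨r (σ⁻¹ * s h), hmem _ (N.inv_mem hσ) h⟩)
        simpa using this }
  rw [map_sum, Finset.mul_sum]
  refine Fintype.sum_equiv e _ _ fun h => ?_
  have h1 : γ (s (e h)) = γ (σ * s h) := hγ _ _ (hs (e h))
  rw [h1, hN σ hσ _ (hsN h), map_mul]
  have h3 : (h : M →ₐ[F] Lₛ) x = s h x := by rw [← hr (s h) x, hs h]
  have h4 : (e h : M →ₐ[F] Lₛ) x = σ (s h x) := rfl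
  rw [h3, h4]; ring

lemma exists_fixed_add_mul (h2 : (2 : F) ≠ 0) (H : Subgroup Γ) {a : F} (ha : a ≠ 0) (x : Lₛ)
    (hx : ∀ σ ∈ H, σ (sepSqrt a) = sepSqrt a → σ x = x) :
    ∃ y z : Lₛ, (∀ σ ∈ H, σ y = y) ∧ (∀ σ ∈ H, σ z = z) ∧ x = y + z * sepSqrt a := by
  have h2' := two_ne_zero_sep h2
  have hα := sepSqrt_ne_zero h2 ha
  by_cases h : ∃ ρ ∈ H, sqrtSign a ρ = -1
  · obtain ⟨ρ, hρ, hρa⟩ := h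
    have hsg : ∀ σ, sqrtSign a σ = 1 → σ (sepSqrt a) = sepSqrt a := fun σ h => by
      rw [apply_sepSqrt h2, h]; simp
    have key : ∀ σ ∈ H, (σ (sepSqrt a) = sepSqrt a ∧ σ x = x ∧ σ (ρ x) = ρ x) ∨
        (σ (sepSqrt a) = -sepSqrt a ∧ σ x = ρ x ∧ σ (ρ x) = x) := by
      intro σ hσ
      rcases sqrtSign_eq_or a σ with h | h
      · refine Or.inl ⟨hsg σ h, hx σ hσ (hsg σ h), ?_⟩
        have := hx (ρ⁻¹ * σ * ρ) (H.mul_mem (H.mul_mem (H.inv_mem hρ) hσ) hρ) (hsg _ (by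
          rw [mul_assoc, sqrtSign_comp h2 ha, sqrtSign_comp h2 ha, h, one_mul,
            ← sqrtSign_comp h2 ha]
          simp [sqrtSign]))
        have h3 := congrArg ρ this
        rw [← AlgEquiv.mul_apply, ← mul_assoc, ← mul_assoc, mul_inv_cancel, one_mul] at h3
        exact h3
      · refine Or.inr ⟨by rw [apply_sepSqrt h2, h]; simp, ?_, ?_⟩
        · have := hx (ρ⁻¹ * σ) (H.mul_mem (H.inv_mem hρ) hσ) (hsg _ (by
            have h5 : sqrtSign a ρ * sqrtSign a (ρ⁻¹ * σ) = sqrtSign a σ := by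
              rw [← sqrtSign_comp h2 ha]; simp
            rw [hρa, h] at h5
            simpa using h5))
          have h3 := congrArg ρ this
          rw [← AlgEquiv.mul_apply, ← mul_assoc, mul_inv_cancel, one_mul] at h3
          exact h3
        · exact hx (σ * ρ) (H.mul_mem hσ hρ) (hsg _ (by
            rw [sqrtSign_comp h2 ha, h, hρa]; simp))
    have hσ2 : ∀ σ : Γ, σ (2 : Lₛ) = 2 := fun σ => map_ofNat σ 2
    refine ⟨(x + ρ x) / 2, (x - ρ x) / (2 * sepSqrt a), fun σ hσ => ?_, fun σ hσ => ?_, ?_⟩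
    · rcases key σ hσ with ⟨_, h3, h4⟩ | ⟨_, h3, h4⟩
      · simp [h3, h4, hσ2]
      · simp [h3, h4, hσ2, add_comm]
    · rcases key σ hσ with ⟨h5, h3, h4⟩ | ⟨h5, h3, h4⟩
      · simp [h3, h4, h5, hσ2]
      · simp only [map_div₀, map_sub, map_mul, hσ2, h3, h4, h5]
        field_simp
        ring
    · field_simp; ring
  · push Not at h
    refine ⟨x, 0, fun σ hσ => hx σ hσ ?_, by simp, by simp⟩
    rw [apply_sepSqrt h2, (sqrtSign_eq_or a σ).resolve_right (h σ hσ)]; simp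

/-- Descent of isotropy of `⟨1, -a, -b⟩` from `F(√f)` to isotropy of `⟨1, -a, -b, abf⟩`. -/
lemma isotropic_of_sqrt_isotropic {K : Type*} [Field K] [Algebra F K] (h2 : (2 : F) ≠ 0)
    {a b f : F} (ha : a ≠ 0) (hb : b ≠ 0) {κ : K} (hκ : κ ^ 2 = algebraMap F K f)
    {p q : Fin 3 → F}
    (hne : ∃ i, algebraMap F K (p i) + algebraMap F K (q i) * κ ≠ 0)
    (h : (algebraMap F K (p 0) + algebraMap F K (q 0) * κ) ^ 2
      - algebraMap F K a * (algebraMap F K (p 1) + algebraMap F K (q 1) * κ) ^ 2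
      - algebraMap F K b * (algebraMap F K (p 2) + algebraMap F K (q 2) * κ) ^ 2 = 0) :
    ∃ x₀ x₁ x₂ x₃ : F, (x₀ ≠ 0 ∨ x₁ ≠ 0 ∨ x₂ ≠ 0 ∨ x₃ ≠ 0) ∧
      x₀ ^ 2 - a * x₁ ^ 2 - b * x₂ ^ 2 + a * b * f * x₃ ^ 2 = 0 := by
  have hinj := (algebraMap F K).injective
  have three : ∀ r : Fin 3 → F, (∃ i, r i ≠ 0) → r 0 ^ 2 - a * r 1 ^ 2 - b * r 2 ^ 2 = 0 →
      ∃ x₀ x₁ x₂ x₃ : F, (x₀ ≠ 0 ∨ x₁ ≠ 0 ∨ x₂ ≠ 0 ∨ x₃ ≠ 0) ∧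
        x₀ ^ 2 - a * x₁ ^ 2 - b * x₂ ^ 2 + a * b * f * x₃ ^ 2 = 0 := by
    intro r hr h
    refine ⟨r 0, r 1, r 2, 0, ?_, by simpa using h⟩
    obtain ⟨i, hi⟩ := hr
    fin_cases i <;> simp_all
  set B := p 0 * q 0 - a * (p 1 * q 1) - b * (p 2 * q 2) with hB
  set m := q 0 ^ 2 - a * q 1 ^ 2 - b * q 2 ^ 2 with hm
  set n := p 0 ^ 2 - a * p 1 ^ 2 - b * p 2 ^ 2 with hn
  have hsplit : algebraMap F K (n + f * m) + algebraMap F K (2 * B) * κ = 0 := by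
    rw [hB, hm, hn, ← h]
    simp only [map_add, map_sub, map_mul, map_pow, map_ofNat, ← hκ]
    ring
  by_cases hκF : ∃ k, algebraMap F K k = κ
  · obtain ⟨k, rfl⟩ := hκF
    refine three (fun i => p i + q i * k) ?_ ?_
    · obtain ⟨i, hi⟩ := hne
      refine ⟨i, fun h0 => hi ?_⟩
      simpa using congrArg (algebraMap F K) h0
    · apply hinj
      simpa using h
  have hB0 : B = 0 := by
    by_contra hB0
    refine hκF ⟨-(n + f * m) / (2 * B), ?_⟩
    have h2B : algebraMap F K (2 * B) ≠ 0 := (_root_.map_ne_zero _).2 (mul_ne_zero h2 hB0)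
    rw [map_div₀, div_eq_iff h2B, map_neg]
    linear_combination -hsplit
  have hnm : n + f * m = 0 := by
    rw [hB0] at hsplit
    apply hinj
    simpa using hsplit
  by_cases hm0 : m = 0
  · have hn0 : n = 0 := by simpa [hm0] using hnm
    by_cases hq : ∃ i, q i ≠ 0
    · exact three q hq hm0
    · push Not at hq
      refine three p ?_ hn0
      obtain ⟨i, hi⟩ := hne
      refine ⟨i, fun h0 => hi ?_⟩
      simp [h0, hq]
  refine ⟨p 1 * q 2 - p 2 * q 1, (p 2 * q 0 - p 0 * q 2) / a, (p 0 * q 1 - p 1 * q 0) / b,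
    m / (a * b), Or.inr (Or.inr (Or.inr (div_ne_zero hm0 (mul_ne_zero ha hb)))), ?_⟩
  have key : a * b * (p 1 * q 2 - p 2 * q 1) ^ 2 - b * (p 2 * q 0 - p 0 * q 2) ^ 2
      - a * (p 0 * q 1 - p 1 * q 0) ^ 2 + f * m ^ 2 = 0 := by
    have : a * b * (p 1 * q 2 - p 2 * q 1) ^ 2 - b * (p 2 * q 0 - p 0 * q 2) ^ 2
      - a * (p 0 * q 1 - p 1 * q 0) ^ 2 = n * m - B ^ 2 := by rw [hn, hm, hB]; ring
    rw [this, hB0]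
    linear_combination m * hnm
  field_simp
  linear_combination key

theorem isotropic_of_galoisSymbol_eq (h2 : (2 : F) ≠ 0) {a b f t : F} (ha : a ≠ 0) (hb : b ≠ 0)
    (hf : f ≠ 0) (h : galoisSymbol h2 a b = galoisSymbol h2 f t) :
    ∃ x₀ x₁ x₂ x₃ : F, (x₀ ≠ 0 ∨ x₁ ≠ 0 ∨ x₂ ≠ 0 ∨ x₃ ≠ 0) ∧
      x₀ ^ 2 - a * x₁ ^ 2 - b * x₂ ^ 2 + a * b * f * x₃ ^ 2 = 0 := by
  have hmem : (cupCochain f t)⁻¹ * cupCochain a b ∈ finiteCoboundaries F :=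
    QuotientGroup.eq.1 (Additive.ofMul.injective h).symm
  obtain ⟨γ, S, h0, hS, hγ⟩ := hmem
  have hone := one_ne_neg_one_sep (F := F) h2
  have hsg1 : ∀ {c : F} {σ : Γ}, sqrtSign c σ = 1 ↔ σ (sepSqrt c) = sepSqrt c := by
    intro c σ
    unfold sqrtSign; split_ifs with h <;> simp [h, hone.symm]
  let H : Subgroup Γ :=
    { carrier := {σ | sqrtSign f σ = 1}
      one_mem' := hsg1.2 rfl
      mul_mem' := fun {σ τ} hσ hτ => by
        simp only [Set.mem_ofPred_eq] at hσ hτ ⊢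
        rw [sqrtSign_comp h2 hf, hσ, hτ, one_mul]
      inv_mem' := fun {σ} hσ => by
        simp only [Set.mem_ofPred_eq] at hσ ⊢
        have := sqrtSign_comp h2 hf σ σ⁻¹
        rw [hσ, one_mul, mul_inv_cancel] at this
        rw [← this]; exact hsg1.2 rfl }
  let N : Subgroup Γ :=
    { carrier := {σ | σ ∈ H ∧ sqrtSign a σ = 1}
      one_mem' := ⟨H.one_mem, hsg1.2 rfl⟩
      mul_mem' := fun {σ τ} hσ hτ =>
        ⟨H.mul_mem hσ.1 hτ.1, by rw [sqrtSign_comp h2 ha, hσ.2, hτ.2, one_mul]⟩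
      inv_mem' := fun {σ} hσ => ⟨H.inv_mem hσ.1, by
        have := sqrtSign_comp h2 ha σ σ⁻¹
        rw [hσ.2, one_mul, mul_inv_cancel] at this
        rw [← this]; exact hsg1.2 rfl⟩ }
  have hc1 : ∀ σ : Γ, ∀ τ ∈ N, γ (σ * τ) = γ σ * σ (γ τ) := by
    intro σ τ hτ
    have hτf : sqrtSign f τ = 1 := hτ.1
    have hτa : sqrtSign a τ = 1 := hτ.2
    rw [← hγ]; simp [cupCochain, hτf, hτa]
  have hc2 : ∀ σ : Γ, ∀ τ ∈ H, sqrtSign a τ = -1 →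
      sqrtSign b σ * γ (σ * τ) = γ σ * σ (γ τ) := by
    intro σ τ hτ hτa
    have hτf : sqrtSign f τ = 1 := hτ
    rw [← hγ]; simp [cupCochain, hτf, hτa, hone.symm]
  obtain ⟨u, hu0, hu⟩ := exists_ne_zero_twisted_fixed N γ S h0 hS fun σ _ τ hτ => hc1 σ τ hτ
  -- elements fixed by `H` lie in `F(√f)`
  have hK : ∀ x : Lₛ, (∀ σ ∈ H, σ x = x) → ∃ p q : F,
      x = algebraMap F Lₛ p + algebraMap F Lₛ q * sepSqrt f := by
    intro x hx
    obtain ⟨y, z, hy, hz, hxyz⟩ := exists_fixed_add_mul h2 ⊤ hf x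
      fun σ _ hσ => hx σ (hsg1.2 hσ)
    have hbot : ∀ w : Lₛ, (∀ σ ∈ (⊤ : Subgroup Γ), σ w = w) → ∃ p, algebraMap F Lₛ p = w :=
      fun w hw => IntermediateField.mem_bot.1
        ((InfiniteGalois.mem_bot_iff_fixed w).2 fun σ => hw σ trivial)
    obtain ⟨p, rfl⟩ := hbot y hy
    obtain ⟨q, rfl⟩ := hbot z hz
    exact ⟨p, q, hxyz⟩
  suffices hX : ∃ X : Fin 3 → Lₛ, (∀ i, ∀ σ ∈ H, σ (X i) = X i) ∧ (∃ i, X i ≠ 0) ∧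
      X 0 ^ 2 - algebraMap F Lₛ a * X 1 ^ 2 - algebraMap F Lₛ b * X 2 ^ 2 = 0 by
    obtain ⟨X, hXH, hX0, hX⟩ := hX
    choose p q hpq using fun i => hK (X i) (hXH i)
    refine isotropic_of_sqrt_isotropic h2 ha hb (sepSqrt_sq h2 f) (p := p) (q := q) ?_ ?_
    · simpa only [← hpq] using hX0
    · simpa only [← hpq] using hX
  by_cases hτ0 : ∃ τ ∈ H, sqrtSign a τ = -1
  · obtain ⟨τ, hτH, hτa⟩ := hτ0
    have hβ0 := sepSqrt_ne_zero h2 hb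
    have hβ2 := sepSqrt_sq h2 b
    have hτβ := apply_sepSqrt h2 b τ
    have hee : (sqrtSign b τ : Lₛ) * sqrtSign b τ = 1 := by
      rw [← Units.val_mul, sqrtSign_mul_self, Units.val_one]
    set w := γ τ * τ u / (sepSqrt b * u) with hw
    have hττ : τ * τ ∈ N := ⟨H.mul_mem hτH hτH, by rw [sqrtSign_comp h2 ha, hτa]; simp⟩
    have hwN : ∀ σ ∈ H, σ (sepSqrt a) = sepSqrt a → σ w = w := by
      intro σ hσ hσa
      have hσN : σ ∈ N := ⟨hσ, hsg1.2 hσa⟩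
      have hconj : τ⁻¹ * (σ * τ) ∈ N := by
        refine ⟨H.mul_mem (H.inv_mem hτH) (H.mul_mem hσ hτH), ?_⟩
        have h5 : sqrtSign a τ * sqrtSign a (τ⁻¹ * (σ * τ)) = sqrtSign a (σ * τ) := by
          rw [← sqrtSign_comp h2 ha]; simp
        rw [sqrtSign_comp h2 ha σ, hσN.2, one_mul, hτa] at h5
        simpa using h5
      have h1 := hc2 σ τ hτH hτa
      have h3 := hc1 τ _ hconj
      have h4 := congrArg τ (hu _ hconj)
      rw [map_mul, ← AlgEquiv.mul_apply τ, mul_inv_cancel_left] at h4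
      rw [mul_inv_cancel_left] at h3
      have h6 := hu σ hσN
      have hσβ := apply_sepSqrt h2 b σ
      have hσsig : (sqrtSign b σ : Lₛ) * sqrtSign b σ = 1 := by
        rw [← Units.val_mul, sqrtSign_mul_self, Units.val_one]
      have hσu : σ u ≠ 0 := by simpa using hu0
      have e0 : (sqrtSign b σ : Lₛ) ≠ 0 := Units.ne_zero _
      rw [AlgEquiv.mul_apply] at h4
      rw [hw, map_div₀, map_mul, map_mul, hσβ,
        div_eq_div_iff (mul_ne_zero (mul_ne_zero e0 hβ0) hσu) (mul_ne_zero hβ0 hu0)]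
      linear_combination -(σ (γ τ) * σ (τ u) * sepSqrt b) * h6
        - sepSqrt b * σ u * σ (τ u) * h1 + sqrtSign b σ * sepSqrt b * σ u * σ (τ u) * h3
        + sqrtSign b σ * γ τ * sepSqrt b * σ u * h4
    have hbw : algebraMap F Lₛ b * (w * τ w) = 1 := by
      have h1 := hc2 τ τ hτH hτa
      have h3 := hu _ hττ
      rw [AlgEquiv.mul_apply] at h3
      have hτu : τ u ≠ 0 := by simpa using hu0
      have e0 : (sqrtSign b τ : Lₛ) ≠ 0 := Units.ne_zero _
      rw [← hβ2, hw, map_div₀, map_mul, map_mul, hτβ]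
      field_simp
      linear_combination sqrtSign b τ * h3 - τ (τ u) * h1
    obtain ⟨x, y, hx, hy, hwxy⟩ := exists_fixed_add_mul h2 H ha w hwN
    have hτw : τ w = x - y * sepSqrt a := by
      rw [hwxy, map_add, map_mul, hx τ hτH, hy τ hτH, apply_sepSqrt h2, hτa]
      simp [sub_eq_add_neg]
    refine ⟨![algebraMap F Lₛ b * x, algebraMap F Lₛ b * y, 1], ?_, ⟨2, by simp⟩, ?_⟩
    · intro i σ hσ
      fin_cases i <;> simp [hx σ hσ, hy σ hσ]
    · rw [hτw, hwxy] at hbw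
      have hα2 := sepSqrt_sq h2 a
      simp only [Matrix.cons_val]
      rw [← hα2]
      linear_combination (algebraMap F Lₛ b) * hbw
  · push Not at hτ0
    refine ⟨![sepSqrt a, 1, 0], ?_, ⟨1, by simp⟩, ?_⟩
    · intro i σ hσ
      have := hsg1.1 ((sqrtSign_eq_or a σ).resolve_right (hτ0 σ hσ))
      fin_cases i <;> simp [this]
    · have hα2 := sepSqrt_sq h2 a
      simp only [Matrix.cons_val]
      rw [← hα2]; ring

end GaloisSymbol

section PolynomialPlaces

variable {E : Type*} [Field E]

lemma exists_eq_pow_mul_not_dvd {p u : E[X]} (hp : Irreducible p) (hu : u ≠ 0) :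
    ∃ (n : ℕ) (w : E[X]), u = p ^ n * w ∧ ¬ p ∣ w := by
  have := FiniteMultiplicity.of_prime_left hp.prime hu
  obtain ⟨c, h1, h2⟩ := this.exists_eq_pow_mul_and_not_dvd
  exact ⟨_, c, h1, h2⟩

lemma multiplicity_pow_mul {p w : E[X]} (hp : Irreducible p) (n : ℕ) (hw : ¬ p ∣ w) :
    multiplicity p (p ^ n * w) = n := by
  refine multiplicity_eq_of_dvd_of_not_dvd (dvd_mul_right _ _) ?_
  rw [pow_succ]
  exact fun h => hw ((mul_dvd_mul_iff_left (pow_ne_zero _ hp.ne_zero)).1 h)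

/-- The angular component at `p`. -/
noncomputable def adicAngular (p u : E[X]) : AdjoinRoot p :=
  AdjoinRoot.mk p (u / p ^ multiplicity p u)

lemma adicAngular_pow_mul {p w : E[X]} (hp : Irreducible p) (n : ℕ) (hw : ¬ p ∣ w) :
    adicAngular p (p ^ n * w) = AdjoinRoot.mk p w := by
  rw [adicAngular, multiplicity_pow_mul hp n hw, mul_div_cancel_left₀ _ (pow_ne_zero _ hp.ne_zero)]

lemma multiplicity_of_not_dvd {p w : E[X]} (hw : ¬ p ∣ w) : multiplicity p w = 0 :=
  multiplicity_eq_zero.2 hw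

lemma adicAngular_of_not_dvd {p w : E[X]} (hw : ¬ p ∣ w) :
    adicAngular p w = AdjoinRoot.mk p w := by
  rw [adicAngular, multiplicity_of_not_dvd hw, pow_zero, EuclideanDomain.div_one]

lemma adjoinRoot_mk_ne_zero {p w : E[X]} (hw : ¬ p ∣ w) : AdjoinRoot.mk p w ≠ 0 :=
  fun h => hw (AdjoinRoot.mk_eq_zero.1 h)

/-- The angular data of the `p`-adic valuation. -/
noncomputable def adicData (p : E[X]) [hp : Fact (Irreducible p)] :
    AngularData E[X] (AdjoinRoot p) where
  v u := multiplicity p u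
  ac := adicAngular p
  v_mul {a b} ha hb := by
    exact_mod_cast multiplicity_mul hp.out.prime
      (FiniteMultiplicity.of_prime_left hp.out.prime (mul_ne_zero ha hb))
  ac_mul {a b} ha hb := by
    obtain ⟨n, u, rfl, hu⟩ := exists_eq_pow_mul_not_dvd hp.out ha
    obtain ⟨m, w, rfl, hw⟩ := exists_eq_pow_mul_not_dvd hp.out hb
    have huw : ¬ p ∣ u * w := fun h => (hp.out.prime.dvd_or_dvd h).elim hu hw
    rw [show p ^ n * u * (p ^ m * w) = p ^ (n + m) * (u * w) by ring,
      adicAngular_pow_mul hp.out _ huw, adicAngular_pow_mul hp.out _ hu,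
      adicAngular_pow_mul hp.out _ hw, map_mul]
  ac_ne_zero {a} ha := by
    obtain ⟨n, u, rfl, hu⟩ := exists_eq_pow_mul_not_dvd hp.out ha
    rw [adicAngular_pow_mul hp.out _ hu]
    exact adjoinRoot_mk_ne_zero hu
  v_neg a := by simp [multiplicity_neg]
  ac_neg a := by
    by_cases ha : a = 0
    · simp [ha, adicAngular]
    obtain ⟨n, u, rfl, hu⟩ := exists_eq_pow_mul_not_dvd hp.out ha
    rw [← mul_neg, adicAngular_pow_mul hp.out _ hu, adicAngular_pow_mul hp.out _ (by rwa [dvd_neg]),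
      map_neg]
  add_of_lt {a b} ha hb h := by
    obtain ⟨n, u, rfl, hu⟩ := exists_eq_pow_mul_not_dvd hp.out ha
    obtain ⟨m, w, rfl, hw⟩ := exists_eq_pow_mul_not_dvd hp.out hb
    rw [multiplicity_pow_mul hp.out _ hu, multiplicity_pow_mul hp.out _ hw] at h
    obtain ⟨d, rfl⟩ := Nat.exists_eq_add_of_lt (Nat.cast_lt.1 h)
    have hd : p ∣ p ^ (d + 1) * w := Dvd.dvd.mul_right (dvd_pow_self p d.succ_ne_zero) w
    have h1 : ¬ p ∣ u + p ^ (d + 1) * w := fun h => hu ((dvd_add_left hd).1 h)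
    rw [show p ^ n * u + p ^ (n + d + 1) * w = p ^ n * (u + p ^ (d + 1) * w) by ring,
      multiplicity_pow_mul hp.out _ hu, multiplicity_pow_mul hp.out _ h1,
      adicAngular_pow_mul hp.out _ hu, adicAngular_pow_mul hp.out _ h1, map_add,
      AdjoinRoot.mk_eq_zero.2 hd, add_zero]
    exact ⟨rfl, rfl⟩
  add_of_eq {a b} ha hb h hs := by
    obtain ⟨n, u, rfl, hu⟩ := exists_eq_pow_mul_not_dvd hp.out ha
    obtain ⟨m, w, rfl, hw⟩ := exists_eq_pow_mul_not_dvd hp.out hb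
    rw [multiplicity_pow_mul hp.out _ hu, multiplicity_pow_mul hp.out _ hw] at h
    obtain rfl : n = m := Nat.cast_injective h
    rw [adicAngular_pow_mul hp.out _ hu, adicAngular_pow_mul hp.out _ hw, ← map_add] at hs
    have h1 : ¬ p ∣ u + w := fun h => hs (AdjoinRoot.mk_eq_zero.2 h)
    rw [← mul_add, multiplicity_pow_mul hp.out _ h1, multiplicity_pow_mul hp.out _ hu]

/-- The angular data of the degree valuation. -/
noncomputable def degreeData : AngularData E[X] E where
  v u := -(u.natDegree : ℤ)
  ac := leadingCoeff
  v_mul ha hb := by rw [natDegree_mul ha hb]; push_cast; ring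
  ac_mul _ _ := leadingCoeff_mul _ _
  ac_ne_zero ha := leadingCoeff_ne_zero.2 ha
  v_neg a := by rw [natDegree_neg]
  ac_neg a := leadingCoeff_neg a
  add_of_lt {a b} ha hb h := by
    have h1 : b.natDegree < a.natDegree := by lia
    rw [natDegree_add_eq_left_of_natDegree_lt h1,
      leadingCoeff_add_of_degree_lt' (degree_lt_degree h1)]
    exact ⟨rfl, rfl⟩
  add_of_eq {a b} ha hb h hs := by
    have h1 : a.natDegree = b.natDegree := by lia
    have h2 : a.degree = b.degree := by
      rw [degree_eq_natDegree ha, degree_eq_natDegree hb, h1]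
    have h3 := degree_add_eq_of_leadingCoeff_add_ne_zero hs
    rw [h2, max_self, ← h2] at h3
    rw [natDegree_eq_of_degree_eq h3]

end PolynomialPlaces

/-- Monic irreducible polynomials, i.e. the finite places of the rational function field. -/
abbrev MonicIrred (E : Type*) [Field E] : Type _ := {p : E[X] // p.Monic ∧ Irreducible p}

instance {E : Type*} [Field E] (p : MonicIrred E) : Fact (Irreducible p.1) := ⟨p.2.2⟩

/-- A symbol on polynomials together with homomorphisms computing all its tame symbols. -/
structure ResidueSymbol (E A : Type*) [Field E] [AddCommGroup A] where
  sym : QuadSymbol E[X] A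
  res (p : MonicIrred E) : A →+ SqCl (AdjoinRoot p.1)
  res_sym : ∀ p u w, u ≠ 0 → w ≠ 0 → res p (sym u w) = (adicData p.1).tame u w
  resInfty : A →+ SqCl E
  resInfty_sym : ∀ u w, u ≠ 0 → w ≠ 0 → resInfty (sym u w) = degreeData.tame u w

namespace ResidueSymbol

variable {E A : Type*} [Field E] [AddCommGroup A] (s : ResidueSymbol E A)

/-- The subgroup generated by symbols of polynomials of degree at most `d`. -/
def level (d : ℕ) : AddSubgroup A :=
  AddSubgroup.closure {x | ∃ u w : E[X], u ≠ 0 ∧ w ≠ 0 ∧ u.natDegree ≤ d ∧ w.natDegree ≤ d ∧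
    x = s.sym u w}

variable {s} {d : ℕ}

lemma sym_mem_level {u w : E[X]} (hu : u ≠ 0) (hw : w ≠ 0) (hud : u.natDegree ≤ d)
    (hwd : w.natDegree ≤ d) : s.sym u w ∈ s.level d :=
  AddSubgroup.subset_closure ⟨u, w, hu, hw, hud, hwd, rfl⟩

lemma not_dvd_of_natDegree_lt {p u : E[X]} (hu : u ≠ 0) (h : u.natDegree < p.natDegree) :
    ¬ p ∣ u := fun h' => h.not_ge (natDegree_le_of_dvd h' hu)

lemma res_sym_of_not_dvd (p : MonicIrred E) {u w : E[X]} (hu : ¬ p.1 ∣ u) (hw : ¬ p.1 ∣ w) :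
    s.res p (s.sym u w) = 0 := by
  rw [s.res_sym p u w (by rintro rfl; simp at hu) (by rintro rfl; simp at hw)]
  simp [AngularData.tame, adicData, multiplicity_of_not_dvd hu, multiplicity_of_not_dvd hw]

lemma res_sym_self_left (p : MonicIrred E) {w : E[X]} (hw : ¬ p.1 ∣ w) :
    s.res p (s.sym p.1 w) = sqCl (AdjoinRoot.mk p.1 w) := by
  rw [s.res_sym p _ w p.2.2.ne_zero (by rintro rfl; simp at hw)]
  simp [AngularData.tame, adicData, multiplicity_of_not_dvd hw, adicAngular_of_not_dvd hw]

lemma res_of_mem_level (p : MonicIrred E) (h : d < p.1.natDegree) {x : A} (hx : x ∈ s.level d) :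
    s.res p x = 0 := by
  induction hx using AddSubgroup.closure_induction with
  | mem x hx =>
    obtain ⟨u, w, hu, hw, hud, hwd, rfl⟩ := hx
    exact res_sym_of_not_dvd p (not_dvd_of_natDegree_lt hu (by lia))
      (not_dvd_of_natDegree_lt hw (by lia))
  | zero => simp
  | add x y _ _ hx hy => rw [map_add, hx, hy, add_zero]
  | neg x _ hx => rw [map_neg, hx, neg_zero]

lemma natDegree_modByMonic_le_of_succ {p : E[X]} (hp : p.Monic) (hpd : p.natDegree = d + 1)
    (h : E[X]) : (h %ₘ p).natDegree ≤ d := by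
  have h1 : p ≠ 1 := by rintro rfl; simp at hpd
  have := natDegree_modByMonic_lt h hp h1
  lia

/-- Symbols at a place of degree `d + 1` are additive in the second entry modulo lower degree. -/
lemma exists_sym_add_sub_mem (p : MonicIrred E) (hpd : p.1.natDegree = d + 1) {h₁ h₂ : E[X]}
    (h10 : h₁ ≠ 0) (h20 : h₂ ≠ 0) (h1d : h₁.natDegree ≤ d) (h2d : h₂.natDegree ≤ d) :
    ∃ h₃, h₃ ≠ 0 ∧ h₃.natDegree ≤ d ∧
      s.sym p.1 h₁ + s.sym p.1 h₂ - s.sym p.1 h₃ ∈ s.level d := by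
  have hp0 := p.2.2.ne_zero
  have h12 := mul_ne_zero h10 h20
  have hnd : ¬ p.1 ∣ h₁ * h₂ := fun h => (p.2.2.prime.dvd_or_dvd h).elim
    (not_dvd_of_natDegree_lt h10 (by lia)) (not_dvd_of_natDegree_lt h20 (by lia))
  have h30 : (h₁ * h₂) %ₘ p.1 ≠ 0 := fun h => hnd ((modByMonic_eq_zero_iff_dvd p.2.1).1 h)
  have h3d := natDegree_modByMonic_le_of_succ p.2.1 hpd (h₁ * h₂)
  have hdiv := modByMonic_add_div (h₁ * h₂) p.1
  have hqd : ((h₁ * h₂) /ₘ p.1).natDegree ≤ d := by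
    rw [natDegree_divByMonic _ p.2.1, natDegree_mul h10 h20]; lia
  set h₃ := (h₁ * h₂) %ₘ p.1
  set q := (h₁ * h₂) /ₘ p.1
  refine ⟨h₃, h30, h3d, ?_⟩
  by_cases hq : q = 0
  · rw [hq, mul_zero, add_zero] at hdiv
    rw [hdiv, s.sym.mul_right hp0 h10 h20, sub_self]
    exact zero_mem _
  have hst := s.sym.steinberg h12 h30 (mul_ne_zero hp0 hq) hdiv.symm
  have h312 := mul_ne_zero h30 h12
  rw [mul_assoc p.1, s.sym.mul_right h312 hp0 (mul_ne_zero hq h12), s.sym.mul_right h312 hq h12,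
    s.sym.mul_right h312 h10 h20, s.sym.symm h312 hp0, s.sym.mul_right hp0 h30 h12,
    s.sym.mul_right hp0 h10 h20] at hst
  have hmem : ∀ {x : E[X]}, x ≠ 0 → x.natDegree ≤ d → s.sym (h₃ * (h₁ * h₂)) x ∈ s.level d := by
    intro x hx hxd
    rw [s.sym.mul_left h30 h12 hx, s.sym.mul_left h10 h20 hx]
    exact add_mem (sym_mem_level h30 hx h3d hxd)
      (add_mem (sym_mem_level h10 hx h1d hxd) (sym_mem_level h20 hx h2d hxd))
  have h33 := s.sym.add_self hp0 h30
  have : s.sym p.1 h₁ + s.sym p.1 h₂ - s.sym p.1 h₃ =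
      -(s.sym (h₃ * (h₁ * h₂)) q + (s.sym (h₃ * (h₁ * h₂)) h₁ + s.sym (h₃ * (h₁ * h₂)) h₂)) := by
    linear_combination (norm := module) hst - h33
  rw [this]
  exact neg_mem (add_mem (hmem hq hqd) (add_mem (hmem h10 h1d) (hmem h20 h2d)))

lemma sym_mem_level_of_isSquare (p : MonicIrred E) (hpd : p.1.natDegree = d + 1) {h : E[X]}
    (h0 : h ≠ 0) (hd : h.natDegree ≤ d) (hsq : IsSquare (AdjoinRoot.mk p.1 h)) :
    s.sym p.1 h ∈ s.level d := by
  have hp0 := p.2.2.ne_zero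
  obtain ⟨z, hz⟩ := hsq
  obtain ⟨r₀, rfl⟩ := AdjoinRoot.mk_surjective z
  set r := r₀ %ₘ p.1
  have hrd : r.natDegree ≤ d := natDegree_modByMonic_le_of_succ p.2.1 hpd r₀
  have hr : AdjoinRoot.mk p.1 r = AdjoinRoot.mk p.1 r₀ := by
    rw [AdjoinRoot.mk_eq_mk, ← dvd_neg]
    exact ⟨r₀ /ₘ p.1, by linear_combination -modByMonic_add_div r₀ p.1⟩
  obtain ⟨q, hq⟩ : p.1 ∣ h - r ^ 2 := by
    rw [← AdjoinRoot.mk_eq_mk, map_pow, hr, hz, pow_two]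
  by_cases hq0 : q = 0
  · rw [hq0, mul_zero, sub_eq_zero] at hq
    have hr0 : r ≠ 0 := by rintro h1; rw [h1] at hq; simp at hq; exact h0 hq
    rw [hq, s.sym.sq_right hp0 hr0]
    exact zero_mem _
  have hqd : q.natDegree ≤ d := by
    have h1 : (h - r ^ 2).natDegree ≤ 2 * d := by
      refine (natDegree_sub_le _ _).trans (max_le (by lia) ?_)
      rw [natDegree_pow]; lia
    rw [hq, natDegree_mul hp0 hq0] at h1
    lia
  have hnq := neg_ne_zero.2 hq0
  have h1 : s.sym (p.1 * -q) h = 0 :=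
    s.sym.norm_eq (x := r) (y := 1) (mul_ne_zero hp0 hnq) h0 (by linear_combination hq)
  rw [s.sym.mul_left hp0 hnq h0] at h1
  rw [eq_neg_of_add_eq_zero_left h1]
  exact neg_mem (sym_mem_level hnq h0 (by rwa [natDegree_neg]) hd)

variable (s) in
/-- Sums of symbols `(p, h)` with `deg h ≤ d`, `deg p = d + 1`, modulo lower degree. -/
def layer (d : ℕ) : AddSubgroup A where
  carrier := {x | ∃ (S : Finset (MonicIrred E)) (h : MonicIrred E → E[X]),
    (∀ p ∈ S, p.1.natDegree = d + 1) ∧ (∀ p, h p ≠ 0 ∧ (h p).natDegree ≤ d) ∧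
    (∀ p ∉ S, h p = 1) ∧ x - ∑ p ∈ S, s.sym p.1 (h p) ∈ s.level d}
  zero_mem' := ⟨∅, 1, by simp, by simp, by simp, by simp⟩
  add_mem' := by
    classical
    rintro x y ⟨S, h, hS, h0, h1, hx⟩ ⟨T, k, hT, k0, k1, hy⟩
    have key : ∀ p : MonicIrred E, ∃ l : E[X], l ≠ 0 ∧ l.natDegree ≤ d ∧ (p ∉ S ∪ T → l = 1) ∧
        (p ∈ S ∪ T → s.sym p.1 (h p) + s.sym p.1 (k p) - s.sym p.1 l ∈ s.level d) := by
      intro p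
      by_cases hp : p ∈ S ∪ T
      · have hpd : p.1.natDegree = d + 1 := (Finset.mem_union.1 hp).elim (hS p) (hT p)
        obtain ⟨l, hl⟩ := exists_sym_add_sub_mem (s := s) p hpd (h0 p).1 (k0 p).1 (h0 p).2 (k0 p).2
        exact ⟨l, hl.1, hl.2.1, fun h => absurd hp h, fun _ => hl.2.2⟩
      · exact ⟨1, one_ne_zero, by simp, fun _ => rfl, fun h => absurd h hp⟩
    choose l l0 ld l1 hl using key
    refine ⟨S ∪ T, l, fun p hp => (Finset.mem_union.1 hp).elim (hS p) (hT p),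
      fun p => ⟨l0 p, ld p⟩, l1, ?_⟩
    have e1 : ∑ p ∈ S, s.sym p.1 (h p) = ∑ p ∈ S ∪ T, s.sym p.1 (h p) :=
      Finset.sum_subset Finset.subset_union_left fun p _ hp => by
        rw [h1 p hp, s.sym.one_right p.2.2.ne_zero]
    have e2 : ∑ p ∈ T, s.sym p.1 (k p) = ∑ p ∈ S ∪ T, s.sym p.1 (k p) :=
      Finset.sum_subset Finset.subset_union_right fun p _ hp => by
        rw [k1 p hp, s.sym.one_right p.2.2.ne_zero]
    have := add_mem (add_mem hx hy) (sum_mem (S := s.level d) hl)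
    rw [e1, e2, Finset.sum_sub_distrib, Finset.sum_add_distrib] at this
    convert this using 1
    abel
  neg_mem' := by
    rintro x ⟨S, h, hS, h0, h1, hx⟩
    refine ⟨S, h, hS, h0, h1, ?_⟩
    have e : ∑ p ∈ S, s.sym p.1 (h p) + ∑ p ∈ S, s.sym p.1 (h p) = 0 := by
      rw [← Finset.sum_add_distrib]
      exact Finset.sum_eq_zero fun p _ => s.sym.add_self p.2.2.ne_zero (h0 p).1
    have := neg_mem hx
    convert this using 1
    linear_combination (norm := module) -e

lemma level_le_layer : s.level d ≤ s.layer d := fun x hx =>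
  ⟨∅, 1, by simp, by simp, by simp, by simpa⟩

lemma sym_mem_layer (p : MonicIrred E) (hpd : p.1.natDegree = d + 1) {h : E[X]} (h0 : h ≠ 0)
    (hd : h.natDegree ≤ d) : s.sym p.1 h ∈ s.layer d := by
  classical
  refine ⟨{p}, fun q => if q = p then h else 1, by simpa, fun q => ?_, fun q hq => ?_, ?_⟩
  · dsimp only; split_ifs <;> simp [*]
  · simp only [Finset.mem_singleton] at hq; simp [hq]
  · simp

/-- Polynomials of degree at most `d` and monic irreducible ones of degree `d + 1`. -/
def IsLayerAtom (d : ℕ) (u : E[X]) : Prop :=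
  u ≠ 0 ∧ (u.natDegree ≤ d ∨ (u.Monic ∧ Irreducible u) ∧ u.natDegree = d + 1)

lemma exists_atoms {u : E[X]} (hu : u ≠ 0) (hd : u.natDegree ≤ d + 1) :
    ∃ u₁ u₂, IsLayerAtom d u₁ ∧ IsLayerAtom d u₂ ∧ u = u₁ * u₂ := by
  by_cases h : u.natDegree ≤ d
  · exact ⟨u, 1, ⟨hu, Or.inl h⟩, ⟨one_ne_zero, Or.inl (by simp)⟩, by simp⟩
  have hd' : u.natDegree = d + 1 := by lia
  by_cases hi : Irreducible u
  · have hl := leadingCoeff_ne_zero.2 hu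
    refine ⟨C u.leadingCoeff, u * C u.leadingCoeff⁻¹, ⟨C_ne_zero.2 hl, Or.inl (by simp)⟩,
      ⟨mul_ne_zero hu (C_ne_zero.2 (inv_ne_zero hl)), Or.inr ⟨⟨monic_mul_leadingCoeff_inv hu, ?_⟩,
      ?_⟩⟩, ?_⟩
    · exact irreducible_mul_leadingCoeff_inv.2 hi
    · rw [natDegree_mul_leadingCoeff_inv _ hu, hd']
    · rw [mul_comm u, ← mul_assoc, ← C_mul, mul_inv_cancel₀ hl, C_1, one_mul]
  · have hnu : ¬ IsUnit u := not_isUnit_of_natDegree_pos _ (by lia)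
    rw [irreducible_iff] at hi
    push Not at hi
    obtain ⟨v, w, rfl, hv, hw⟩ := hi hnu
    have hv0 := left_ne_zero_of_mul hu
    have hw0 := right_ne_zero_of_mul hu
    rw [natDegree_mul hv0 hw0] at hd'
    have pos : ∀ {x : E[X]}, x ≠ 0 → ¬ IsUnit x → 0 < x.natDegree := fun {x} hx hx' =>
      natDegree_pos_iff_degree_pos.2 (degree_pos_of_ne_zero_of_nonunit hx hx')
    have := pos hv0 hv
    have := pos hw0 hw
    exact ⟨v, w, ⟨hv0, Or.inl (by lia)⟩, ⟨hw0, Or.inl (by lia)⟩, rfl⟩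

lemma sym_atom_mem_layer {u w : E[X]} (hu : IsLayerAtom d u) (hw : IsLayerAtom d w) :
    s.sym u w ∈ s.layer d := by
  obtain ⟨hu0, hu | ⟨hu, hud⟩⟩ := hu <;> obtain ⟨hw0, hw | ⟨hw, hwd⟩⟩ := hw
  · exact level_le_layer (sym_mem_level hu0 hw0 hu hw)
  · rw [s.sym.symm hu0 hw0]
    exact sym_mem_layer ⟨w, hw⟩ hwd hu0 hu
  · exact sym_mem_layer ⟨u, hu⟩ hud hw0 hw
  have h1 : (-1 : E[X]) ≠ 0 := neg_ne_zero.2 one_ne_zero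
  have h1d : (-1 : E[X]).natDegree ≤ d := by simp
  by_cases huw : w = u
  · rw [huw, s.sym.self_eq hu0]
    exact sym_mem_layer ⟨u, hu⟩ hud h1 h1d
  have hh := sub_ne_zero.2 huw
  have hhd : (w - u).natDegree ≤ d := by
    have h3 : (w - u).degree < w.degree := degree_sub_lt_left
      (by rw [degree_eq_natDegree hw0, degree_eq_natDegree hu0, hud, hwd]) hw0
      (by rw [hw.1.leadingCoeff, hu.1.leadingCoeff])
    have := natDegree_lt_natDegree hh h3
    lia
  have hst := s.sym.steinberg (u := w) (w := u) (v := w - u) hw0 hu0 hh (by ring)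
  have huw0 := mul_ne_zero hu0 hw0
  rw [s.sym.mul_right huw0 hh hw0, s.sym.mul_left hu0 hw0 hh, s.sym.mul_left hu0 hw0 hw0,
    s.sym.self_eq hw0] at hst
  have : s.sym u w = -(s.sym u (w - u) + s.sym w (w - u) + s.sym w (-1)) := by
    linear_combination (norm := module) hst
  rw [this]
  exact neg_mem (add_mem (add_mem (sym_mem_layer ⟨u, hu⟩ hud hh hhd)
    (sym_mem_layer ⟨w, hw⟩ hwd hh hhd)) (sym_mem_layer ⟨w, hw⟩ hwd h1 h1d))

lemma level_succ_le_layer : s.level (d + 1) ≤ s.layer d := by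
  refine (AddSubgroup.closure_le _).2 ?_
  rintro x ⟨u, w, hu, hw, hud, hwd, rfl⟩
  obtain ⟨u₁, u₂, h1, h2, rfl⟩ := exists_atoms hu hud
  obtain ⟨w₁, w₂, k1, k2, rfl⟩ := exists_atoms hw hwd
  rw [s.sym.mul_left h1.1 h2.1 hw, s.sym.mul_right h1.1 k1.1 k2.1, s.sym.mul_right h2.1 k1.1 k2.1]
  exact add_mem (add_mem (sym_atom_mem_layer h1 k1) (sym_atom_mem_layer h1 k2))
    (add_mem (sym_atom_mem_layer h2 k1) (sym_atom_mem_layer h2 k2))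

lemma mem_level_of_res_eq_zero {x : A} (hx : x ∈ s.level (d + 1)) (h0 : ∀ p, s.res p x = 0) :
    x ∈ s.level d := by
  obtain ⟨S, h, hS, hh, -, hy⟩ := level_succ_le_layer hx
  have hnd : ∀ p, p ∈ S → ∀ q, ¬ p.1 ∣ h q := fun p hp q =>
    not_dvd_of_natDegree_lt (hh q).1 (by have := hS p hp; have := (hh q).2; lia)
  have key : ∀ p ∈ S, s.sym p.1 (h p) ∈ s.level d := by
    intro p hp
    refine sym_mem_level_of_isSquare p (hS p hp) (hh p).1 (hh p).2 ?_
    have h1 := res_of_mem_level p (by have := hS p hp; lia) hy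
    rw [map_sub, h0, zero_sub, neg_eq_zero, map_sum, Finset.sum_eq_single_of_mem p hp,
      res_sym_self_left p (hnd p hp p)] at h1
    · exact (sqCl_eq_zero_iff (adjoinRoot_mk_ne_zero (hnd p hp p))).1 h1
    · intro q hq hqp
      refine res_sym_of_not_dvd p (fun h => hqp ?_) (hnd p hp q)
      exact Subtype.ext (eq_of_monic_of_associated q.2.1 p.2.1
        (p.2.2.associated_of_dvd q.2.2 h).symm)
  simpa using add_mem hy (sum_mem key)

lemma level_zero (hu : ∀ b : Fin 3 → E, (∀ i, b i ≠ 0) → IsotropicDiag b) {x : A}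
    (hx : x ∈ s.level 0) : x = 0 := by
  refine AddSubgroup.mem_bot.1 ((AddSubgroup.closure_le ⊥).2 ?_ hx)
  rintro x ⟨u, w, hu0, hw0, hud, hwd, rfl⟩
  obtain ⟨e, rfl⟩ : ∃ e, u = C e := ⟨_, eq_C_of_natDegree_le_zero hud⟩
  obtain ⟨e', rfl⟩ : ∃ e, w = C e := ⟨_, eq_C_of_natDegree_le_zero hwd⟩
  have he := C_ne_zero.1 hu0
  have he' := C_ne_zero.1 hw0
  obtain ⟨y, hy0, hy⟩ := hu ![1, -e, -e'] (by intro i; fin_cases i <;> simp [he, he'])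
  simp only [Fin.sum_univ_three, Matrix.cons_val] at hy
  change s.sym _ _ = 0
  by_cases h2 : y 2 = 0
  · have h1 : y 1 ≠ 0 := by
      intro h1
      refine hy0 (funext fun i => ?_)
      simp only [h1, h2] at hy
      fin_cases i
      · simpa using hy
      · exact h1
      · exact h2
    have : e = (y 0 / y 1) ^ 2 := by
      rw [h2] at hy; field_simp; linear_combination -hy
    have h3 : y 0 / y 1 ≠ 0 := by rintro h3; rw [h3] at this; simp at this; exact he this
    rw [this, C_pow, s.sym.sq_left (C_ne_zero.2 h3) hw0]
  · refine s.sym.norm_eq (x := C (y 0 / y 2)) (y := C (y 1 / y 2)) hu0 hw0 ?_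
    rw [← C_pow, ← C_pow, ← C_mul, ← C_sub]
    congr 1
    field_simp
    linear_combination -hy

/-- Unramified classes are trivial when all ternary forms over `E` are isotropic. -/
theorem eq_zero_of_res_eq_zero (hu : ∀ b : Fin 3 → E, (∀ i, b i ≠ 0) → IsotropicDiag b) {x : A}
    (hx : x ∈ s.level d) (h0 : ∀ p, s.res p x = 0) : x = 0 := by
  induction d with
  | zero => exact level_zero hu hx
  | succ d ih => exact ih (mem_level_of_res_eq_zero hx h0)

end ResidueSymbol

section NormResultant

lemma det_aeval_eq_resultant_of_splits {K n : Type*} [Field K] [Fintype n] [DecidableEq n]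
    (M : Matrix n n K) {A : K[X]} (hA : A.Splits) :
    (aeval M A).det = resultant M.charpoly A := by
  let φ : K[X] →* K := Matrix.detMonoidHom.comp
    (MonoidHomClass.toMonoidHom (aeval M : K[X] →ₐ[K] Matrix n n K))
  have hφ : ∀ B, φ B = (aeval M B).det := fun _ => rfl
  rw [← hφ, resultant_comm, resultant_eq_prod_eval _ _ _ le_rfl hA]
  conv_lhs => rw [hA.eq_prod_roots, map_mul, map_multiset_prod, Multiset.map_map]
  have h1 : φ (C A.leadingCoeff) = A.leadingCoeff ^ M.charpoly.natDegree := by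
    rw [hφ, aeval_C, Matrix.algebraMap_eq_diagonal, Matrix.det_diagonal]
    simp [M.charpoly_natDegree_eq_dim]
  have h2 : A.roots.map (φ ∘ fun a => X - C a) =
      A.roots.map fun a => (-1) ^ M.charpoly.natDegree * M.charpoly.eval a := by
    refine Multiset.map_congr rfl fun a _ => ?_
    rw [Function.comp_apply, hφ, Matrix.eval_charpoly, map_sub, aeval_X, aeval_C, ← neg_sub,
      Matrix.det_neg, M.charpoly_natDegree_eq_dim]
    rfl
  rw [h1, h2, Multiset.prod_map_mul, Multiset.map_const', Multiset.prod_replicate,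
    ← hA.natDegree_eq_card_roots, ← pow_mul]
  ring

lemma det_aeval_eq_resultant {K n : Type*} [Field K] [Fintype n] [DecidableEq n]
    (M : Matrix n n K) (A : K[X]) : (aeval M A).det = resultant M.charpoly A := by
  let L := AlgebraicClosure K
  apply (algebraMap K L).injective
  have h := det_aeval_eq_resultant_of_splits (M.map (algebraMap K L))
    (IsAlgClosed.splits (A.map (algebraMap K L)))
  have h1 : aeval (M.map (algebraMap K L)) (A.map (algebraMap K L)) =
      (aeval M A).map (algebraMap K L) := by
    rw [aeval_map_algebraMap]
    exact aeval_algHom_apply (AlgHom.mapMatrix (Algebra.ofId K L)) M A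
  rw [h1, Matrix.charpoly_map, natDegree_map, natDegree_map, resultant_map_map] at h
  rw [← h, RingHom.map_det]
  rfl

variable {E : Type*} [Field E]

lemma norm_mk_eq_resultant {f : E[X]} (hf : f ≠ 0) (A : E[X]) :
    Algebra.norm E (AdjoinRoot.mk f A) = resultant (f * C f.leadingCoeff⁻¹) A := by
  have hchar := charpoly_leftMulMatrix (AdjoinRoot.powerBasis hf)
  rw [AdjoinRoot.powerBasis_gen, AdjoinRoot.minpoly_root hf] at hchar
  rw [Algebra.norm_eq_matrix_det (AdjoinRoot.powerBasis hf).basis, ← hchar,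
    ← det_aeval_eq_resultant, ← AdjoinRoot.aeval_eq]
  congr 1
  exact (aeval_algHom_apply (Algebra.leftMulMatrix (AdjoinRoot.powerBasis hf).basis)
    (AdjoinRoot.root f) A).symm

lemma norm_mk_monic {f : E[X]} (hf : f.Monic) (A : E[X]) :
    Algebra.norm E (AdjoinRoot.mk f A) = resultant f A := by
  rw [norm_mk_eq_resultant hf.ne_zero, hf.leadingCoeff, inv_one, C_1, mul_one]

lemma norm_mk_reciprocity {p q : E[X]} (hp : p.Monic) (hq : q.Monic) :
    Algebra.norm E (AdjoinRoot.mk p q) =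
      (-1) ^ (p.natDegree * q.natDegree) * Algebra.norm E (AdjoinRoot.mk q p) := by
  rw [norm_mk_monic hp, norm_mk_monic hq, resultant_comm]

lemma norm_mk_prod {f : E[X]} (hf : f ≠ 0) {ι : Type*} (S : Finset ι) (p : ι → E[X])
    (hp : ∀ i ∈ S, (p i).Monic) (hfp : f * C f.leadingCoeff⁻¹ = ∏ i ∈ S, p i) (A : E[X]) :
    Algebra.norm E (AdjoinRoot.mk f A) = ∏ i ∈ S, Algebra.norm E (AdjoinRoot.mk (p i) A) := by
  have h1 : ∏ i ∈ S, (p i).leadingCoeff ≠ 0 := by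
    rw [Finset.prod_congr rfl fun i hi => (hp i hi).leadingCoeff]; simp
  rw [norm_mk_eq_resultant hf, hfp, resultant_prod_left S p A _ h1 le_rfl]
  exact Finset.prod_congr rfl fun i hi => (norm_mk_monic (hp i hi) A).symm

end NormResultant

section SqClMap

variable {k k' : Type*} [Field k] [Field k']

/-- The map on square classes induced by a multiplicative map. -/
noncomputable def SqCl.map (φ : k →* k') : SqCl k →+ SqCl k' :=
  MonoidHom.toAdditive (QuotientGroup.map (powMonoidHom 2 : kˣ →* kˣ).range
    (powMonoidHom 2 : k'ˣ →* k'ˣ).range (Units.map φ) (by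
      rintro _ ⟨x, rfl⟩
      exact ⟨Units.map φ x, by simp⟩))

lemma map_ne_zero_of_ne (φ : k →* k') {u : k} (hu : u ≠ 0) : φ u ≠ 0 :=
  (Units.map φ (Units.mk0 u hu)).ne_zero

lemma SqCl.map_sqCl (φ : k →* k') {u : k} (hu : u ≠ 0) : SqCl.map φ (sqCl u) = sqCl (φ u) := by
  rw [sqCl_of_ne hu, sqCl_of_ne (map_ne_zero_of_ne φ hu)]
  have : Units.mk0 (φ u) (map_ne_zero_of_ne φ hu) = Units.map φ (Units.mk0 u hu) :=
    Units.ext rfl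
  rw [this]
  rfl

end SqClMap

/-- The norm on square classes of the residue field at `p`. -/
noncomputable def placeNorm {E : Type*} [Field E] (p : MonicIrred E) :
    SqCl (AdjoinRoot p.1) →+ SqCl E :=
  SqCl.map (Algebra.norm E)

namespace ResidueSymbol

variable {E A : Type*} [Field E] [AddCommGroup A] {s : ResidueSymbol E A}

lemma not_dvd_of_ne {p q : MonicIrred E} (h : p ≠ q) : ¬ p.1 ∣ q.1 := fun h' =>
  h (Subtype.ext (eq_of_monic_of_associated p.2.1 q.2.1 (p.2.2.associated_of_dvd q.2.2 h')))

lemma not_dvd_C (p : MonicIrred E) {c : E} (hc : c ≠ 0) : ¬ p.1 ∣ C c := fun h =>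
  p.2.2.not_isUnit (isUnit_of_dvd_unit h (isUnit_C.2 hc.isUnit))

variable (s) in
/-- The classes satisfying the sum formula for their residues. -/
def sumFormula : AddSubgroup A where
  carrier := {x | ∃ S₀ : Finset (MonicIrred E), ∀ S, S₀ ⊆ S →
    ∑ p ∈ S, placeNorm p (s.res p x) = s.resInfty x}
  zero_mem' := ⟨∅, fun S _ => by simp⟩
  add_mem' := by
    classical
    rintro x y ⟨S, hS⟩ ⟨T, hT⟩
    refine ⟨S ∪ T, fun U hU => ?_⟩
    simp only [map_add, Finset.sum_add_distrib]
    rw [hS U (Finset.union_subset_left hU), hT U (Finset.union_subset_right hU)]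
  neg_mem' := by
    rintro x ⟨S, hS⟩
    refine ⟨S, fun U hU => ?_⟩
    simp only [map_neg, Finset.sum_neg_distrib]
    rw [hS U hU]

lemma sym_C_C_mem {a b : E} (ha : a ≠ 0) (hb : b ≠ 0) : s.sym (C a) (C b) ∈ s.sumFormula := by
  refine ⟨∅, fun S _ => ?_⟩
  rw [s.resInfty_sym _ _ (C_ne_zero.2 ha) (C_ne_zero.2 hb)]
  rw [Finset.sum_eq_zero fun p _ => by
    rw [res_sym_of_not_dvd p (not_dvd_C p ha) (not_dvd_C p hb), map_zero]]
  simp [AngularData.tame, degreeData]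

lemma sym_self_C_mem (p : MonicIrred E) {a : E} (ha : a ≠ 0) :
    s.sym p.1 (C a) ∈ s.sumFormula := by
  refine ⟨{p}, fun S hS => ?_⟩
  rw [s.resInfty_sym _ _ p.2.2.ne_zero (C_ne_zero.2 ha),
    Finset.sum_eq_single_of_mem p (hS (by simp)) fun q _ hq => by
      rw [res_sym_of_not_dvd q (not_dvd_of_ne hq) (not_dvd_C q ha), map_zero],
    res_sym_self_left p (not_dvd_C p ha), placeNorm,
    SqCl.map_sqCl _ (adjoinRoot_mk_ne_zero (not_dvd_C p ha))]
  have h1 : Algebra.norm E (AdjoinRoot.mk p.1 (C a)) = a ^ p.1.natDegree := by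
    rw [AdjoinRoot.mk_C, ← AdjoinRoot.algebraMap_eq, Algebra.norm_algebraMap,
      (AdjoinRoot.powerBasis p.2.2.ne_zero).finrank, AdjoinRoot.powerBasis_dim]
  have h2 := (p.1.natDegree • sqCl a).add_self
  rw [h1, sqCl_pow ha]
  simp only [AngularData.tame, degreeData, natDegree_C, leadingCoeff_C, p.2.1.leadingCoeff,
    sqCl_one]
  simp only [Nat.cast_zero, neg_zero, mul_zero, zero_smul, smul_zero, zero_add, neg_smul,
    natCast_zsmul]
  exact (neg_eq_of_add_eq_zero_left h2).symm

lemma sym_place_place_mem (p q : MonicIrred E) : s.sym p.1 q.1 ∈ s.sumFormula := by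
  classical
  by_cases hpq : p = q
  · subst hpq
    rw [s.sym.self_eq p.2.2.ne_zero, ← C_1, ← C_neg]
    exact sym_self_C_mem p (neg_ne_zero.2 one_ne_zero)
  refine ⟨{p, q}, fun S hS => ?_⟩
  have hnp := not_dvd_of_ne hpq
  have hnq := not_dvd_of_ne (Ne.symm hpq)
  rw [s.resInfty_sym _ _ p.2.2.ne_zero q.2.2.ne_zero,
    ← Finset.sum_subset hS fun r _ hr => by
      simp only [Finset.mem_insert, Finset.mem_singleton, not_or] at hr
      rw [res_sym_of_not_dvd r (not_dvd_of_ne hr.1) (not_dvd_of_ne hr.2), map_zero],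
    Finset.sum_pair hpq, res_sym_self_left p hnp, s.sym.symm p.2.2.ne_zero q.2.2.ne_zero,
    res_sym_self_left q hnq, placeNorm, placeNorm, SqCl.map_sqCl _ (adjoinRoot_mk_ne_zero hnp),
    SqCl.map_sqCl _ (adjoinRoot_mk_ne_zero hnq), norm_mk_reciprocity p.2.1 q.2.1]
  have h1 := map_ne_zero_of_ne (Algebra.norm E) (adjoinRoot_mk_ne_zero hnq)
  have hm : (-1 : E) ≠ 0 := neg_ne_zero.2 one_ne_zero
  rw [sqCl_mul (pow_ne_zero _ hm) h1, add_assoc, SqCl.add_self, add_zero, sqCl_pow hm]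
  simp only [AngularData.tame, degreeData, p.2.1.leadingCoeff, q.2.1.leadingCoeff, sqCl_one,
    smul_zero, add_zero, neg_mul_neg]
  rw [← Nat.cast_mul, natCast_zsmul]

/-- Induction on nonzero polynomials along monic irreducible factors. -/
lemma monicIrred_induction {P : E[X] → Prop} (hC : ∀ c, c ≠ 0 → P (C c))
    (hp : ∀ (p : MonicIrred E), P p.1)
    (hmul : ∀ a b, a ≠ 0 → b ≠ 0 → P a → P b → P (a * b)) {u : E[X]} (hu : u ≠ 0) : P u := by
  induction u using UniqueFactorizationMonoid.induction_on_prime with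
  | h₁ => exact absurd rfl hu
  | h₂ x hx =>
    obtain ⟨c, hc, rfl⟩ := Polynomial.isUnit_iff.1 hx
    exact hC c hc.ne_zero
  | h₃ a r ha hr ih =>
    refine hmul _ _ hr.ne_zero ha ?_ (ih ha)
    have hl := leadingCoeff_ne_zero.2 hr.ne_zero
    have : r = C r.leadingCoeff * (r * C r.leadingCoeff⁻¹) := by
      rw [mul_comm r, ← mul_assoc, ← C_mul, mul_inv_cancel₀ hl, C_1, one_mul]
    rw [this]
    exact hmul _ _ (C_ne_zero.2 hl) (mul_ne_zero hr.ne_zero (C_ne_zero.2 (inv_ne_zero hl)))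
      (hC _ hl) (hp ⟨_, monic_mul_leadingCoeff_inv hr.ne_zero,
        irreducible_mul_leadingCoeff_inv.2 hr.irreducible⟩)

theorem sym_mem_sumFormula {u w : E[X]} (hu : u ≠ 0) (hw : w ≠ 0) :
    s.sym u w ∈ s.sumFormula := by
  refine monicIrred_induction (P := fun u => s.sym u w ∈ s.sumFormula) (fun c hc => ?_)
    (fun p => ?_) (fun a b ha hb h1 h2 => ?_) hu
  · refine monicIrred_induction (P := fun w => s.sym (C c) w ∈ s.sumFormula)
      (fun c' hc' => sym_C_C_mem hc hc') (fun p => ?_) (fun a b ha hb h1 h2 => ?_) hw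
    · rw [s.sym.symm (C_ne_zero.2 hc) p.2.2.ne_zero]
      exact sym_self_C_mem p hc
    · rw [s.sym.mul_right (C_ne_zero.2 hc) ha hb]
      exact add_mem h1 h2
  · refine monicIrred_induction (P := fun w => s.sym p.1 w ∈ s.sumFormula)
      (fun c' hc' => sym_self_C_mem p hc') (fun q => sym_place_place_mem p q)
      (fun a b ha hb h1 h2 => ?_) hw
    rw [s.sym.mul_right p.2.2.ne_zero ha hb]
    exact add_mem h1 h2
  · rw [s.sym.mul_left ha hb hw]
    exact add_mem h1 h2

end ResidueSymbol

section LocalConditions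

/-- An isotropic vector over the completion is approximated by a vector over the field itself. -/
lemma IsotropicCompletion.exists_approx {F : Type*} [Field F]
    {v : Valuation F (WithZero (Multiplicative ℤ))} {n : ℕ} {a : Fin n → F} (ha : ∀ i, a i ≠ 0)
    (h : IsotropicCompletion v a) :
    ∃ (j : Fin n) (y : Fin n → F), y j = 1 ∧ v (∑ i, a i * y i ^ 2) < v (a j) := by
  let _ : Valued F (WithZero (Multiplicative ℤ)) := Valued.mk' v
  obtain ⟨x, hx, hsum⟩ := h
  obtain ⟨j, hj⟩ : ∃ j, x j ≠ 0 := by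
    by_contra! h0
    exact hx (funext h0)
  refine ⟨j, ?_⟩
  let K := UniformSpace.Completion F
  let G : (Fin n → K) → K := fun w => ∑ i, ((a i : F) : K) * (Function.update w j 1) i ^ 2
  have hG : Continuous G := by
    refine continuous_finsetSum _ fun i _ => continuous_const.mul (Continuous.pow ?_ 2)
    exact (continuous_apply i).comp (continuous_id.update j continuous_const)
  let U : Set (Fin n → K) := {w | Valued.v.restrict (G w) < Valued.v.restrict ((a j : F) : K)}
  have hU : IsOpen U := (Valued.isOpen_ball K (Valued.v.restrict ((a j : F) : K))).preimage hG
  have hmem : (fun i => x i / x j) ∈ U := by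
    have h0 : G (fun i => x i / x j) = 0 := by
      have : G (fun i => x i / x j) = (∑ i, ((a i : F) : K) * x i ^ 2) / x j ^ 2 := by
        rw [Finset.sum_div]
        refine Finset.sum_congr rfl fun i _ => ?_
        have : Function.update (fun i => x i / x j) j 1 i = x i / x j := by
          by_cases hi : i = j
          · subst hi; simp [div_self hj]
          · simp [hi]
        rw [this, div_pow, mul_div_assoc]
      rw [this]
      exact (congrArg (· / x j ^ 2) hsum).trans (zero_div _)
    have hc : ((a j : F) : K) ≠ 0 := by
      simpa using ha j
    rw [Set.mem_ofPred_eq, h0, map_zero, zero_lt_iff]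
    simpa using hc
  have hd : DenseRange (Pi.map (fun (_ : Fin n) (z : F) => (z : K))) :=
    DenseRange.piMap fun _ => UniformSpace.Completion.denseRange_coe
  obtain ⟨w, hw⟩ := hd.exists_mem_open hU ⟨_, hmem⟩
  refine ⟨Function.update w j 1, by simp, ?_⟩
  have hGw : G (Pi.map (fun (_ : Fin n) (z : F) => (z : K)) w) =
      ((∑ i, a i * Function.update w j 1 i ^ 2 : F) : K) := by
    change _ = UniformSpace.Completion.coeRingHom _
    rw [map_sum]
    refine Finset.sum_congr rfl fun i _ => ?_
    rw [map_mul, map_pow]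
    congr 2
    by_cases hi : i = j
    · subst hi; simp
    · simp [hi, Pi.map]
      rfl
  rw [Set.mem_ofPred_eq, hGw] at hw
  have := (Valuation.restrict_lt_iff _).1 hw
  rw [Valued.valuedCompletion_apply, Valued.valuedCompletion_apply] at this
  exact this

end LocalConditions

namespace AngularData

variable {R k : Type*} [CommRing R] [Field k] (D : AngularData R k)

/-- `a` and `b` are nonzero and have the same tame symbols. -/
def TameEquiv (a b : R) : Prop :=
  a ≠ 0 ∧ b ≠ 0 ∧ ∀ c, c ≠ 0 → D.tame a c = D.tame b c

variable {D}

lemma TameEquiv.refl {a : R} (ha : a ≠ 0) : D.TameEquiv a a := ⟨ha, ha, fun _ _ => rfl⟩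

lemma TameEquiv.trans {a b c : R} (h : D.TameEquiv a b) (h' : D.TameEquiv b c) :
    D.TameEquiv a c :=
  ⟨h.1, h'.2.1, fun x hx => (h.2.2 x hx).trans (h'.2.2 x hx)⟩

lemma TameEquiv.symm {a b : R} (h : D.TameEquiv a b) : D.TameEquiv b a :=
  ⟨h.2.1, h.1, fun x hx => (h.2.2 x hx).symm⟩

lemma TameEquiv.tame_eq {a b a' b' : R} (h : D.TameEquiv a b) (h' : D.TameEquiv a' b') :
    D.tame a a' = D.tame b b' := by
  rw [h.2.2 _ h'.1, D.tame_symm, h'.2.2 _ h.2.1, D.tame_symm]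

variable [IsDomain R]

lemma TameEquiv.mul {a b a' b' : R} (h : D.TameEquiv a b) (h' : D.TameEquiv a' b') :
    D.TameEquiv (a * a') (b * b') := by
  refine ⟨mul_ne_zero h.1 h'.1, mul_ne_zero h.2.1 h'.2.1, fun c hc => ?_⟩
  rw [D.tame_symm, D.tame_symm _ c, D.tame_mul_right h.1 h'.1, D.tame_mul_right h.2.1 h'.2.1,
    D.tame_symm c, D.tame_symm c, D.tame_symm c, D.tame_symm c, h.2.2 c hc, h'.2.2 c hc]

lemma TameEquiv.neg {a b : R} (h : D.TameEquiv a b) : D.TameEquiv (-a) (-b) := by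
  simpa using (TameEquiv.refl (D := D) (neg_ne_zero.2 one_ne_zero)).mul h

lemma TameEquiv.of_mul_sq {a d : R} (ha : a ≠ 0) (hd : d ≠ 0) : D.TameEquiv a (a * d ^ 2) := by
  refine ⟨ha, mul_ne_zero ha (pow_ne_zero _ hd), fun c _ => ?_⟩
  rw [D.tame_symm _ c, D.tame_symm _ c, D.tame_mul_right ha (pow_ne_zero _ hd), D.tame_sq hd,
    add_zero]

/-- An approximate zero of a four-dimensional diagonal form of determinant `δ` forces the
tame symbol of the form to be `(δ, t)` for some `t`. -/
lemma exists_tame_eq {A z : Fin 4 → R} (hA : ∀ i, A i ≠ 0) {j : Fin 4} (hz : z j ≠ 0)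
    (h : ∑ i, A i * z i ^ 2 = 0 ∨ D.v (A j * z j ^ 2) < D.v (∑ i, A i * z i ^ 2)) :
    ∃ t, t ≠ 0 ∧ D.tame (-(A 0 * A 1)) (-(A 0 * A 2)) = D.tame (A 0 * A 1 * A 2 * A 3) t := by
  set ε := ∑ i, A i * z i ^ 2 with hε
  let B : Fin 4 → R := fun i => if i = j then A j * z j ^ 2 - ε else A i * z j ^ 2
  have hAz : ∀ i, A i * z j ^ 2 ≠ 0 := fun i => mul_ne_zero (hA i) (pow_ne_zero _ hz)
  have hAB : ∀ i, D.TameEquiv (A i) (B i) := by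
    intro i
    refine (TameEquiv.of_mul_sq (hA i) hz).trans ?_
    by_cases hi : i = j
    · subst hi
      simp only [B, if_true]
      rcases h with h | h
      · rw [h, sub_zero]
        exact .refl (hAz i)
      · by_cases h0 : ε = 0
        · rw [h0, sub_zero]
          exact .refl (hAz i)
        rw [sub_eq_add_neg]
        obtain ⟨hv, hac⟩ := D.add_of_lt (hAz i) (neg_ne_zero.2 h0) (by rwa [D.v_neg])
        refine ⟨hAz i, fun h1 => ?_, fun c _ => D.tame_congr_left hv.symm hac.symm⟩
        have h2 : A i * z i ^ 2 = ε := by linear_combination h1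
        rw [h2] at h
        exact lt_irrefl _ h
    · simp only [B, if_neg hi]
      exact .refl (hAz i)
  have hsum : ∑ i, B i * z i ^ 2 = 0 := by
    have h1 : ∀ i, B i * z i ^ 2 = A i * z i ^ 2 * z j ^ 2 - if i = j then ε * z i ^ 2 else 0 := by
      intro i
      by_cases hi : i = j
      · subst hi; simp only [B, if_true]; ring
      · simp only [B, if_neg hi]; ring
    simp only [h1, Finset.sum_sub_distrib, ← Finset.sum_mul, Finset.sum_ite_eq',
      Finset.mem_univ, if_true]
    rw [← hε, sub_self]
  have hB : ∀ i, B i ≠ 0 := fun i => (hAB i).2.1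
  have hE₁ : D.TameEquiv (-(A 0 * A 1)) (-(B 0 * B 1)) := ((hAB 0).mul (hAB 1)).neg
  have hE₂ : D.TameEquiv (-(A 0 * A 2)) (-(B 0 * B 2)) := ((hAB 0).mul (hAB 2)).neg
  have hE₃ : D.TameEquiv (A 0 * A 1 * A 2 * A 3) (B 0 * B 1 * B 2 * B 3) :=
    (((hAB 0).mul (hAB 1)).mul (hAB 2)).mul (hAB 3)
  have hc : B 0 * B 1 * B 2 ≠ 0 := mul_ne_zero (mul_ne_zero (hB 0) (hB 1)) (hB 2)
  obtain ⟨t, ht, hs⟩ := D.tameSymbol.exists_eq_of_isotropic (a := -(B 0 * B 1))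
    (b := -(B 0 * B 2)) (f := B 0 * B 1 * B 2 * B 3) (x₀ := B 0 * B 1 * B 2 * (B 0 * z 0))
    (x₁ := B 0 * B 1 * B 2 * z 1) (x₂ := B 0 * B 1 * B 2 * z 2) (x₃ := z 3) hE₁.2.1 hE₂.2.1 hE₃.2.1
    (by
      rw [Fin.sum_univ_four] at hsum
      linear_combination (B 0 * B 1 * B 2) ^ 2 * B 0 * hsum)
    (by
      have hj : ∀ i, z i ≠ 0 → z 0 ≠ 0 ∨ z 1 ≠ 0 ∨ z 2 ≠ 0 ∨ z 3 ≠ 0 := by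
        intro i hi
        fin_cases i <;> simp_all
      rcases hj j hz with h | h | h | h
      · exact Or.inl (mul_ne_zero hc (mul_ne_zero (hB 0) h))
      · exact Or.inr (Or.inl (mul_ne_zero hc h))
      · exact Or.inr (Or.inr (Or.inl (mul_ne_zero hc h)))
      · exact Or.inr (Or.inr (Or.inr h)))
  exact ⟨t, ht, (hE₁.tame_eq hE₂).trans (hs.trans (hE₃.symm.tame_eq (.refl ht)))⟩

end AngularData

section PolynomialLocalConditions

variable {E : Type*} [Field E]

lemma exists_tame_eq_of_isotropicCompletion {k : Type*} [Field k] (D : AngularData E[X] k)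
    {v : Valuation (RatFunc E) (WithZero (Multiplicative ℤ))}
    (hv : ∀ u w : E[X], w ≠ 0 → v (algebraMap E[X] (RatFunc E) u) <
      v (algebraMap E[X] (RatFunc E) w) → u = 0 ∨ D.v w < D.v u)
    {a : Fin 4 → RatFunc E} {A d : Fin 4 → E[X]} (hA : ∀ i, A i ≠ 0) (hd : ∀ i, d i ≠ 0)
    (hAd : ∀ i, a i * algebraMap E[X] (RatFunc E) (d i) ^ 2 = algebraMap E[X] (RatFunc E) (A i))
    (h : IsotropicCompletion v a) :
    ∃ t, t ≠ 0 ∧ D.tame (-(A 0 * A 1)) (-(A 0 * A 2)) = D.tame (A 0 * A 1 * A 2 * A 3) t := by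
  have hinj := IsFractionRing.injective E[X] (RatFunc E)
  have hne : ∀ {u : E[X]}, u ≠ 0 → algebraMap E[X] (RatFunc E) u ≠ 0 :=
    fun hu => (map_ne_zero_iff _ hinj).2 hu
  have ha : ∀ i, a i ≠ 0 := by
    intro i h0
    have := hAd i
    rw [h0, zero_mul] at this
    exact hne (hA i) this.symm
  obtain ⟨j, y, hyj, hlt⟩ := h.exists_approx ha
  obtain ⟨m, hm⟩ := IsLocalization.exist_integer_multiples_of_finite (nonZeroDivisors E[X])
    (fun i => y i / algebraMap E[X] (RatFunc E) (d i))
  choose z hz using hm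
  have hm0 : (m : E[X]) ≠ 0 := nonZeroDivisors.coe_ne_zero m
  have hdz : ∀ i, algebraMap E[X] (RatFunc E) (d i) * algebraMap E[X] (RatFunc E) (z i) =
      algebraMap E[X] (RatFunc E) m * y i := by
    intro i
    have := hne (hd i)
    rw [hz i, Algebra.smul_def]
    field_simp
  have hterm : ∀ i, algebraMap E[X] (RatFunc E) (A i * z i ^ 2) =
      algebraMap E[X] (RatFunc E) m ^ 2 * (a i * y i ^ 2) := by
    intro i
    rw [map_mul, map_pow, ← hAd i]
    linear_combination a i * (algebraMap E[X] (RatFunc E) (d i) * algebraMap E[X] (RatFunc E) (z i)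
      + algebraMap E[X] (RatFunc E) m * y i) * hdz i
  have hzj : z j ≠ 0 := by
    intro h0
    have := hdz j
    rw [h0, map_zero, mul_zero, hyj, mul_one] at this
    exact hne hm0 this.symm
  refine D.exists_tame_eq hA hzj (hv _ _ (mul_ne_zero (hA j) (pow_ne_zero _ hzj)) ?_)
  rw [map_sum, hterm, Finset.sum_congr rfl fun i _ => hterm i, ← Finset.mul_sum, map_mul, map_mul,
    hyj, one_pow, mul_one]
  exact (mul_lt_mul_iff_right₀ (zero_lt_iff.2 (by simp [hne hm0]))).2 hlt

lemma exists_valuation_adic (p : MonicIrred E) :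
    ∃ v : Valuation (RatFunc E) (WithZero (Multiplicative ℤ)), IsZValuationTrivialOnBase E v ∧
      ∀ u w : E[X], w ≠ 0 → v (algebraMap E[X] (RatFunc E) u) <
        v (algebraMap E[X] (RatFunc E) w) → u = 0 ∨ (adicData p.1).v w < (adicData p.1).v u := by
  have hp := p.2.2
  let P : IsDedekindDomain.HeightOneSpectrum E[X] :=
    ⟨Ideal.span {p.1}, (Ideal.span_singleton_prime hp.ne_zero).2 hp.prime,
      by simp [hp.ne_zero]⟩
  refine ⟨P.valuation (RatFunc E), ⟨P.valuation_surjective _, fun a => ?_⟩, fun u w hw h => ?_⟩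
  · rw [IsScalarTower.algebraMap_apply E E[X] (RatFunc E),
      IsDedekindDomain.HeightOneSpectrum.valuation_eq_one_iff_notMem]
    rw [Ideal.mem_span_singleton]
    exact ResidueSymbol.not_dvd_C p a.ne_zero
  · by_contra! hcon
    obtain ⟨hu, hle⟩ := hcon
    rw [P.valuation_of_algebraMap, P.valuation_of_algebraMap] at h
    refine absurd h (not_lt.2 ?_)
    have hle' : (multiplicity p.1 u : ℤ) ≤ multiplicity p.1 w := hle
    rw [P.intValuation_eq_exp_neg_multiplicity hu, P.intValuation_eq_exp_neg_multiplicity hw,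
      WithZero.exp_le_exp, neg_le_neg_iff]
    have key : ∀ x : E[X], multiplicity (Ideal.span {p.1}) (Ideal.span {x}) = multiplicity p.1 x :=
      fun x => multiplicity_eq_of_emultiplicity_eq Ideal.emultiplicity_eq_emultiplicity_span
    change (multiplicity (Ideal.span {p.1}) _ : ℤ) ≤ multiplicity (Ideal.span {p.1}) _
    rwa [key, key]

lemma exists_valuation_degree :
    ∃ v : Valuation (RatFunc E) (WithZero (Multiplicative ℤ)), IsZValuationTrivialOnBase E v ∧
      ∀ u w : E[X], w ≠ 0 → v (algebraMap E[X] (RatFunc E) u) <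
        v (algebraMap E[X] (RatFunc E) w) →
        u = 0 ∨ (degreeData (E := E)).v w < (degreeData (E := E)).v u := by
  classical
  refine ⟨RatFunc.inftyValuation E, ⟨fun x => ?_, fun a => ?_⟩, fun u w hw h => ?_⟩
  · by_cases hx : x = 0
    · exact ⟨0, by simp [hx]⟩
    · refine ⟨RatFunc.X ^ (WithZero.log x), ?_⟩
      rw [RatFunc.inftyValuation.X_zpow, WithZero.exp_log hx]
  · exact RatFunc.inftyValuation.C E a.ne_zero
  · by_contra! hcon
    obtain ⟨hu, hle⟩ := hcon
    rw [RatFunc.inftyValuation_apply, RatFunc.inftyValuation_apply,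
      RatFunc.inftyValuation.polynomial E hu, RatFunc.inftyValuation.polynomial E hw,
      WithZero.exp_lt_exp] at h
    have hle' : -(u.natDegree : ℤ) ≤ -(w.natDegree : ℤ) := hle
    omega

end PolynomialLocalConditions

section Places

variable {E : Type*} [Field E]

lemma finite_setOf_dvd {u : E[X]} (hu : u ≠ 0) : {p : MonicIrred E | p.1 ∣ u}.Finite := by
  refine ResidueSymbol.monicIrred_induction (P := fun u => {p : MonicIrred E | p.1 ∣ u}.Finite)
    (fun c hc => ?_) (fun q => ?_) (fun a b _ _ ha hb => ?_) hu
  · refine Set.Finite.subset Set.finite_empty fun p hp => ?_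
    exact absurd hp (ResidueSymbol.not_dvd_C p hc)
  · refine Set.Finite.subset (Set.finite_singleton q) fun p hp => ?_
    by_contra h
    exact ResidueSymbol.not_dvd_of_ne h hp
  · refine (ha.union hb).subset fun p hp => ?_
    exact p.2.2.prime.dvd_or_dvd hp

lemma isCoprime_of_ne {p q : MonicIrred E} (h : p ≠ q) : IsCoprime p.1 q.1 :=
  (p.2.2.coprime_iff_not_dvd).2 (ResidueSymbol.not_dvd_of_ne h)

lemma exists_monicIrred_dvd {u : E[X]} (hu : ¬ IsUnit u) (h0 : u ≠ 0) :
    ∃ p : MonicIrred E, p.1 ∣ u := by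
  obtain ⟨q, hq, hqu⟩ := WfDvdMonoid.exists_irreducible_factor hu h0
  have hl := leadingCoeff_ne_zero.2 hq.ne_zero
  refine ⟨⟨_, monic_mul_leadingCoeff_inv hq.ne_zero, irreducible_mul_leadingCoeff_inv.2 hq⟩, ?_⟩
  exact (IsUnit.mul_right_dvd (isUnit_C.2 (inv_ne_zero hl).isUnit)).2 hqu

/-- A square-free polynomial is, up to a constant, the product of its monic irreducible factors. -/
lemma mul_C_inv_eq_prod {f : E[X]} (h0 : f ≠ 0) (hf : Squarefree f) {S : Finset (MonicIrred E)}
    (hS : ∀ p : MonicIrred E, p ∈ S ↔ p.1 ∣ f) :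
    f * C f.leadingCoeff⁻¹ = ∏ p ∈ S, p.1 := by
  obtain ⟨r, hr⟩ : ∏ p ∈ S, p.1 ∣ f :=
    Finset.prod_dvd_of_coprime (fun p _ q _ hpq => isCoprime_of_ne hpq) fun p hp => (hS p).1 hp
  have hr0 : r ≠ 0 := by
    rintro rfl
    exact h0 (by rw [hr, mul_zero])
  have hru : IsUnit r := by
    by_contra h
    obtain ⟨p, hp⟩ := exists_monicIrred_dvd h hr0
    have hpS : p ∈ S := (hS p).2 (hr ▸ hp.mul_left _)
    refine p.2.2.not_isUnit (hf p.1 ?_)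
    rw [hr]
    exact mul_dvd_mul (Finset.dvd_prod_of_mem (fun p : MonicIrred E => p.1) hpS) hp
  refine eq_of_monic_of_associated (monic_mul_leadingCoeff_inv h0)
    (monic_prod_of_monic _ _ fun p _ => p.2.1) ?_
  have hl := (inv_ne_zero (leadingCoeff_ne_zero.2 h0)).isUnit
  refine (associated_mul_unit_left f _ (isUnit_C.2 hl)).trans ?_
  nth_rewrite 1 [hr]
  exact associated_mul_unit_left _ _ hru

lemma adicData_v_of_not_dvd {p : MonicIrred E} {u : E[X]} (h : ¬ p.1 ∣ u) :
    (adicData p.1).v u = 0 := by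
  simp [adicData, multiplicity_of_not_dvd h]

lemma tame_of_not_dvd_left {p : MonicIrred E} {u w : E[X]} (h : ¬ p.1 ∣ u) :
    (adicData p.1).tame u w = (multiplicity p.1 w : ℤ) • sqCl (AdjoinRoot.mk p.1 u) := by
  rw [AngularData.tame_of_even _ (by rw [adicData_v_of_not_dvd h]; exact Even.zero)]
  simp [adicData, adicAngular_of_not_dvd h]

lemma multiplicity_prod (p : MonicIrred E) (T : Finset (MonicIrred E)) [Decidable (p ∈ T)] :
    multiplicity p.1 (∏ q ∈ T, q.1) = if p ∈ T then 1 else 0 := by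
  classical
  split_ifs with h
  · rw [← Finset.mul_prod_erase _ _ h]
    have := multiplicity_pow_mul p.2.2 1 (w := ∏ q ∈ T.erase p, q.1) ?_
    · rwa [pow_one] at this
    intro hd
    obtain ⟨q, hq, hpq⟩ := (p.2.2.prime.dvd_finsetProd_iff _).1 hd
    exact ResidueSymbol.not_dvd_of_ne (Finset.ne_of_mem_erase hq).symm hpq
  · refine multiplicity_of_not_dvd fun hd => ?_
    obtain ⟨q, hq, hpq⟩ := (p.2.2.prime.dvd_finsetProd_iff _).1 hd
    exact ResidueSymbol.not_dvd_of_ne (p := p) (fun h' => h (by rwa [h'])) hpq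

/-- Square classes at finitely many places are represented by a common polynomial. -/
lemma exists_sqCl_mk_eq (S : Finset (MonicIrred E))
    (y : ∀ p : MonicIrred E, SqCl (AdjoinRoot p.1)) :
    ∃ A : E[X], ∀ p ∈ S, ¬ p.1 ∣ A ∧ sqCl (AdjoinRoot.mk p.1 A) = y p := by
  have h : ∀ p : MonicIrred E, ∃ u : E[X], AdjoinRoot.mk p.1 u ≠ 0 ∧
      sqCl (AdjoinRoot.mk p.1 u) = y p := by
    intro p
    obtain ⟨x, hx, hxy⟩ := exists_sqCl_eq (y p)
    obtain ⟨u, rfl⟩ := AdjoinRoot.mk_surjective x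
    exact ⟨u, hx, hxy⟩
  choose u hu0 hu using h
  obtain ⟨A, hA⟩ := Ideal.exists_forall_sub_mem_ideal
    (I := fun p : S => Ideal.span {p.1.1}) (fun p q hpq => (Ideal.isCoprime_span_singleton_iff _ _).2
      (isCoprime_of_ne (Subtype.coe_ne_coe.2 hpq))) (fun p => u p.1)
  refine ⟨A, fun p hp => ?_⟩
  have h1 : AdjoinRoot.mk p.1 A = AdjoinRoot.mk p.1 (u p) :=
    AdjoinRoot.mk_eq_mk.2 (Ideal.mem_span_singleton.1 (hA ⟨p, hp⟩))
  refine ⟨fun hd => hu0 p ?_, by rw [h1, hu]⟩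
  rw [← h1, AdjoinRoot.mk_eq_zero.2 hd]

end Places

namespace ResidueSymbol

variable {E A : Type*} [Field E] [AddCommGroup A] (s : ResidueSymbol E A)

/-- A class whose residues outside `f` are those of symbols `(f, t)` can be corrected by a symbol
`(f, h)` to be unramified outside `f`. -/
lemma exists_correction {f : E[X]} (hf : f ≠ 0) {a b : E[X]} (ha : a ≠ 0) (hb : b ≠ 0)
    (hfin : ∀ p : MonicIrred E, ∃ t, t ≠ 0 ∧ s.res p (s.sym a b) = (adicData p.1).tame f t)
    (hinf : ∃ t, t ≠ 0 ∧ s.resInfty (s.sym a b) = degreeData.tame f t) :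
    ∃ h, h ≠ 0 ∧ (∀ p : MonicIrred E, ¬ p.1 ∣ f → s.res p (s.sym a b + s.sym f h) = 0) ∧
      (s.resInfty (s.sym a b + s.sym f h) = 0 ∨
        s.resInfty (s.sym a b + s.sym f h) = sqCl f.leadingCoeff) := by
  classical
  have hT : {p : MonicIrred E | ¬ p.1 ∣ f ∧ s.res p (s.sym a b) ≠ 0}.Finite := by
    refine (finite_setOf_dvd (mul_ne_zero ha hb)).subset fun p hp => ?_
    by_contra h
    exact hp.2 (res_sym_of_not_dvd p (fun h' => h (h'.mul_right _)) (fun h' => h (h'.mul_left _)))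
  set g : E[X] := ∏ p ∈ hT.toFinset, p.1 with hg
  have hg0 : g ≠ 0 := Finset.prod_ne_zero_iff.2 fun p _ => p.2.2.ne_zero
  have hgres : ∀ p : MonicIrred E, ¬ p.1 ∣ f → s.res p (s.sym a b + s.sym f g) = 0 := by
    intro p hp
    rw [map_add, s.res_sym p f g hf hg0, tame_of_not_dvd_left hp, hg, multiplicity_prod]
    obtain ⟨t, ht, hres⟩ := hfin p
    rw [tame_of_not_dvd_left hp] at hres
    by_cases h0 : s.res p (s.sym a b) = 0
    · rw [if_neg (by simp [h0]), h0]
      simp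
    · rw [if_pos (by simp [h0, hp])]
      rcases SqCl.zsmul_eq_or (sqCl (AdjoinRoot.mk p.1 f)) (multiplicity p.1 t) with h | h
      · exact absurd (hres.trans h) h0
      · rw [hres, h]
        simpa using SqCl.add_self _
  rcases Int.even_or_odd (degreeData.v f) with hdeg | hdeg
  · refine ⟨g, hg0, hgres, ?_⟩
    obtain ⟨t, ht, hres⟩ := hinf
    rw [map_add, hres, s.resInfty_sym f g hf hg0, AngularData.tame_of_even _ hdeg,
      AngularData.tame_of_even _ hdeg, ← add_smul]
    exact SqCl.zsmul_eq_or _ _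
  · obtain ⟨e, he, hee⟩ := exists_sqCl_eq (s.resInfty (s.sym a b + s.sym f g))
    have hC : (C e : E[X]) ≠ 0 := C_ne_zero.2 he
    have hsplit : s.sym a b + s.sym f (g * C e) = s.sym a b + s.sym f g + s.sym f (C e) := by
      rw [s.sym.mul_right hf hg0 hC, add_assoc]
    refine ⟨g * C e, mul_ne_zero hg0 hC, fun p hp => ?_, Or.inl ?_⟩
    · rw [hsplit, map_add, hgres p hp, res_sym_of_not_dvd p hp (not_dvd_C p he), add_zero]
    · have hv : degreeData.v (C e) = 0 := by simp [degreeData]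
      have hac : degreeData.ac (C e) = e := by simp [degreeData]
      rw [hsplit, map_add, ← hee, s.resInfty_sym f _ hf hC, AngularData.tame_symm,
        AngularData.tame_of_even _ (by rw [hv]; exact Even.zero), hac, SqCl.zsmul_odd _ hdeg,
        SqCl.add_self]

/-- A class unramified outside `f` with prescribed residue at infinity has the same residues at
the divisors of `f` as a polynomial whose norm is a square or `lc f` times a square. -/
lemma exists_norm_eq {f : E[X]} (hf : f ≠ 0) (hsq : Squarefree f) {y : A}
    (hy : y ∈ s.sumFormula) (hres : ∀ p : MonicIrred E, ¬ p.1 ∣ f → s.res p y = 0)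
    (hinf : s.resInfty y = 0 ∨ s.resInfty y = sqCl f.leadingCoeff) :
    ∃ u : E[X], (∀ p : MonicIrred E, p.1 ∣ f → ¬ p.1 ∣ u ∧ sqCl (AdjoinRoot.mk p.1 u) = s.res p y) ∧
      ∃ e : Eˣ, Algebra.norm E (AdjoinRoot.mk f u) = (e : E) ^ 2 ∨
        Algebra.norm E (AdjoinRoot.mk f u) = f.leadingCoeff * (e : E) ^ 2 := by
  classical
  have hS := finite_setOf_dvd hf
  have hmem : ∀ p : MonicIrred E, p ∈ hS.toFinset ↔ p.1 ∣ f := by simp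
  obtain ⟨u, hu⟩ := exists_sqCl_mk_eq hS.toFinset fun p => s.res p y
  refine ⟨u, fun p hp => hu p ((hmem p).2 hp), ?_⟩
  have hne : ∀ p ∈ hS.toFinset, Algebra.norm E (AdjoinRoot.mk p.1 u) ≠ 0 := fun p hp =>
    map_ne_zero_of_ne (Algebra.norm E) (adjoinRoot_mk_ne_zero (hu p hp).1)
  have hnorm := norm_mk_prod hf hS.toFinset (fun p => p.1) (fun p _ => p.2.1)
    (mul_C_inv_eq_prod hf hsq hmem) u
  set N := Algebra.norm E (AdjoinRoot.mk f u) with hN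
  have hN0 : N ≠ 0 := by
    rw [hnorm]
    exact Finset.prod_ne_zero_iff.2 hne
  have hcl : sqCl N = s.resInfty y := by
    obtain ⟨S₀, hS₀⟩ := hy
    rw [← hS₀ (S₀ ∪ hS.toFinset) Finset.subset_union_left, hnorm]
    rw [← Finset.sum_subset (s₁ := hS.toFinset) Finset.subset_union_right fun p _ hp => by
      rw [hres p fun h => hp ((hmem p).2 h), map_zero]]
    have : ∀ T ⊆ hS.toFinset, sqCl (∏ p ∈ T, Algebra.norm E (AdjoinRoot.mk p.1 u)) =
        ∑ p ∈ T, placeNorm p (s.res p y) := by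
      intro T
      induction T using Finset.induction_on with
      | empty => simp [sqCl_one]
      | insert p T hp ih =>
        intro hT
        have hpS := hT (Finset.mem_insert_self p T)
        have hTS := (Finset.subset_insert p T).trans hT
        rw [Finset.prod_insert hp, Finset.sum_insert hp, sqCl_mul (hne p hpS)
          (Finset.prod_ne_zero_iff.2 fun q hq => hne q (hTS hq)), ih hTS, ← (hu p hpS).2,
          placeNorm, SqCl.map_sqCl _ (adjoinRoot_mk_ne_zero (hu p hpS).1)]
    exact this _ subset_rfl
  have hc := leadingCoeff_ne_zero.2 hf
  rcases hinf with h | h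
  · obtain ⟨r, hr⟩ := (sqCl_eq_zero_iff hN0).1 (hcl.trans h)
    have hr0 : r ≠ 0 := by rintro rfl; simp [hN0] at hr
    exact ⟨Units.mk0 r hr0, Or.inl (by rw [hr, Units.val_mk0, pow_two])⟩
  · obtain ⟨r, hr⟩ := (sqCl_eq_iff hN0 hc).1 (hcl.trans h)
    have hr0 : r ≠ 0 := by rintro rfl; simp [hN0, hf] at hr
    refine ⟨Units.mk0 (r / f.leadingCoeff) (div_ne_zero hr0 hc), Or.inr ?_⟩
    rw [Units.val_mk0]
    field_simp
    linear_combination hr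

/-- A square-reflexive polynomial realizes the residues of a class unramified outside `f`. -/
lemma exists_sym_eq_of_mem {f : E[X]} (hf : IsSquareReflexive f) (hf0 : f ≠ 0)
    (hu : ∀ b : Fin 3 → E, (∀ i, b i ≠ 0) → IsotropicDiag b) {y : A} {d : ℕ} (hyd : y ∈ s.level d)
    (hy : y ∈ s.sumFormula) (hres : ∀ p : MonicIrred E, ¬ p.1 ∣ f → s.res p y = 0)
    (hinf : s.resInfty y = 0 ∨ s.resInfty y = sqCl f.leadingCoeff) :
    ∃ g, g ≠ 0 ∧ y = s.sym f g := by
  obtain ⟨u, huf, hnorm⟩ := s.exists_norm_eq hf0 hf.1 hy hres hinf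
  have hcop : IsCoprime f u := by
    refine isCoprime_of_irreducible_dvd (fun h => hf0 h.1) fun q hq hqf hqu => ?_
    obtain ⟨p, hp⟩ := exists_monicIrred_dvd hq.not_isUnit hq.ne_zero
    exact (huf p (hp.trans hqf)).1 (hp.trans hqu)
  have hunit : IsUnit (Ideal.Quotient.mk (Ideal.span {f}) u) := by
    obtain ⟨m, n, hmn⟩ := hcop
    refine IsUnit.of_mul_eq_one (Ideal.Quotient.mk (Ideal.span {f}) n) ?_
    rw [← map_mul, ← map_one (Ideal.Quotient.mk (Ideal.span {f})), Ideal.Quotient.eq,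
      Ideal.mem_span_singleton]
    exact ⟨-m, by linear_combination hmn⟩
  obtain ⟨g, hg0, hgu, hgf⟩ : ∃ g : E[X], g ≠ 0 ∧
      (∀ p : MonicIrred E, p.1 ∣ f → ¬ p.1 ∣ g ∧ sqCl (AdjoinRoot.mk p.1 g) = s.res p y) ∧
      IsSquare (Ideal.Quotient.mk (Ideal.span {g}) f) := by
    obtain ⟨g, hfg, ⟨β, hβ⟩, hsq⟩ := hf.2 hunit.unit hnorm
    by_cases hg0 : g = 0
    · subst hg0
      have hfu := isCoprime_zero_right.1 hfg
      refine ⟨1, one_ne_zero, fun p hp => absurd (isUnit_of_dvd_unit hp hfu) p.2.2.not_isUnit, ?_⟩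
      refine ⟨1, ?_⟩
      rw [mul_one, ← map_one (Ideal.Quotient.mk (Ideal.span {(1 : E[X])})), Ideal.Quotient.eq,
        Ideal.mem_span_singleton]
      exact one_dvd _
    · refine ⟨g, hg0, fun p hp => ?_, hsq⟩
      have hpg : ¬ p.1 ∣ g := fun h => p.2.2.not_isUnit (hfg.isUnit_of_dvd' hp h)
      refine ⟨hpg, ?_⟩
      obtain ⟨B, hB⟩ := Ideal.Quotient.mk_surjective (β : E[X] ⧸ Ideal.span {f})
      rw [IsUnit.unit_spec, ← hB, ← map_pow, ← map_mul, Ideal.Quotient.eq,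
        Ideal.mem_span_singleton] at hβ
      have h1 : AdjoinRoot.mk p.1 g = AdjoinRoot.mk p.1 u * AdjoinRoot.mk p.1 B ^ 2 := by
        rw [← map_pow, ← map_mul]
        exact AdjoinRoot.mk_eq_mk.2 (hp.trans hβ)
      have hg1 := adjoinRoot_mk_ne_zero hpg
      rw [h1] at hg1 ⊢
      rw [sqCl_mul (left_ne_zero_of_mul hg1) (right_ne_zero_of_mul hg1), sqCl_sq, add_zero,
        (huf p hp).2]
  refine ⟨g, hg0, s.sym.eq_of_add_eq_zero hf0 hg0 (eq_zero_of_res_eq_zero hu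
    (d := max d (max f.natDegree g.natDegree)) (s := s) ?_ fun p => ?_)⟩
  · refine add_mem (AddSubgroup.closure_mono ?_ hyd) (sym_mem_level hf0 hg0 (by simp) (by simp))
    rintro x ⟨u, w, hu, hw, hud, hwd, rfl⟩
    exact ⟨u, w, hu, hw, hud.trans (le_max_left _ _), hwd.trans (le_max_left _ _), rfl⟩
  · rw [map_add, s.res_sym p f g hf0 hg0]
    by_cases hp : p.1 ∣ f
    · obtain ⟨hpg, hgy⟩ := hgu p hp
      have hmult : multiplicity p.1 f = 1 := by
        obtain ⟨r, hr⟩ := hp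
        have hpr : ¬ p.1 ∣ r := fun ⟨w, hw⟩ => p.2.2.not_isUnit (hf.1 p.1 ⟨w, by rw [hr, hw]; ring⟩)
        rw [hr, ← multiplicity_pow_mul p.2.2 1 hpr, pow_one]
      rw [AngularData.tame_symm, tame_of_not_dvd_left hpg, hmult, hgy]
      simpa using SqCl.add_self _
    · rw [hres p hp, zero_add, tame_of_not_dvd_left hp]
      by_cases hpg : p.1 ∣ g
      · obtain ⟨x, hx⟩ := hgf
        obtain ⟨r, rfl⟩ := Ideal.Quotient.mk_surjective x
        rw [← map_mul, Ideal.Quotient.eq, Ideal.mem_span_singleton] at hx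
        have h1 : AdjoinRoot.mk p.1 f = AdjoinRoot.mk p.1 r * AdjoinRoot.mk p.1 r := by
          rw [← map_mul]
          exact AdjoinRoot.mk_eq_mk.2 (hpg.trans hx)
        rw [(sqCl_eq_zero_iff (adjoinRoot_mk_ne_zero hp)).2 ⟨_, h1⟩, smul_zero]
      · rw [multiplicity_of_not_dvd hpg]
        simp

/-- A symbol that is locally of the form `(f, t)` with `f` square-reflexive is globally of this
form. -/
theorem exists_sym_eq {f : E[X]} (hf : IsSquareReflexive f) (hf0 : f ≠ 0)
    (hu : ∀ b : Fin 3 → E, (∀ i, b i ≠ 0) → IsotropicDiag b) {a b : E[X]} (ha : a ≠ 0) (hb : b ≠ 0)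
    (hfin : ∀ p : MonicIrred E, ∃ t, t ≠ 0 ∧ s.res p (s.sym a b) = (adicData p.1).tame f t)
    (hinf : ∃ t, t ≠ 0 ∧ s.resInfty (s.sym a b) = degreeData.tame f t) :
    ∃ t, t ≠ 0 ∧ s.sym a b = s.sym f t := by
  obtain ⟨h, hh, hres, hinfty⟩ := s.exists_correction hf0 ha hb hfin hinf
  obtain ⟨g, hg, hyg⟩ := s.exists_sym_eq_of_mem hf hf0 hu
    (d := max (max a.natDegree b.natDegree) (max f.natDegree h.natDegree))
    (add_mem (sym_mem_level ha hb (by simp) (by simp)) (sym_mem_level hf0 hh (by simp) (by simp)))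
    (add_mem (sym_mem_sumFormula ha hb) (sym_mem_sumFormula hf0 hh)) hres hinfty
  refine ⟨g * h, mul_ne_zero hg hh, ?_⟩
  rw [s.sym.mul_right hf0 hg hh, ← hyg, add_assoc, s.sym.add_self hf0 hh, add_zero]

end ResidueSymbol

namespace QuadSymbol

variable {E B : Type*} [Field E] [AddCommGroup B] (g : QuadSymbol E[X] B)

/-- A symbol on polynomials combined with all tame symbols. -/
noncomputable def toResidueSymbol :
    ResidueSymbol E (B × (∀ p : MonicIrred E, SqCl (AdjoinRoot p.1)) × SqCl E) where
  sym :=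
    { toFun u w := (g u w, fun p => (adicData p.1).tame u w, degreeData.tame u w)
      mul_left' _ _ _ hu hw hz := Prod.ext (g.mul_left hu hw hz) <| Prod.ext
        (funext fun p => (adicData p.1).tameSymbol.mul_left hu hw hz)
        (degreeData.tameSymbol.mul_left hu hw hz)
      mul_right' _ _ _ hu hw hz := Prod.ext (g.mul_right hu hw hz) <| Prod.ext
        (funext fun p => (adicData p.1).tameSymbol.mul_right hu hw hz)
        (degreeData.tameSymbol.mul_right hu hw hz)
      norm' u x y hu h := Prod.ext (g.norm' u x y hu h) <| Prod.ext
        (funext fun p => (adicData p.1).tameSymbol.norm' u x y hu h)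
        (degreeData.tameSymbol.norm' u x y hu h) }
  res p := (Pi.evalAddMonoidHom _ p).comp ((AddMonoidHom.fst _ _).comp (AddMonoidHom.snd _ _))
  res_sym _ _ _ _ _ := rfl
  resInfty := (AddMonoidHom.snd _ _).comp (AddMonoidHom.snd _ _)
  resInfty_sym _ _ _ _ := rfl

/-- A symbol whose tame symbols are of the form `(f, t)` with `f` square-reflexive is globally of
this form. -/
theorem exists_eq_of_tame_eq {f : E[X]} (hf : IsSquareReflexive f)
    (hu : ∀ b : Fin 3 → E, (∀ i, b i ≠ 0) → IsotropicDiag b) {a b : E[X]} (ha : a ≠ 0) (hb : b ≠ 0)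
    (hfin : ∀ p : MonicIrred E, ∃ t, t ≠ 0 ∧ (adicData p.1).tame a b = (adicData p.1).tame f t)
    (hinf : ∃ t, t ≠ 0 ∧ degreeData.tame a b = degreeData.tame f t) :
    ∃ t, t ≠ 0 ∧ g a b = g f t := by
  obtain ⟨t, ht, h⟩ := g.toResidueSymbol.exists_sym_eq hf hf.1.ne_zero hu ha hb hfin hinf
  exact ⟨t, ht, congrArg Prod.fst h⟩

end QuadSymbol

/-- A four-dimensional diagonal form over `E(X)` is isotropic if its symbol is of the form
`(f, t)`, where `f` is its determinant. -/
lemma isotropicDiag_of_symbol_eq {F : Type*} [Field F] (h2 : (2 : F) ≠ 0) {a : Fin 4 → F}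
    (ha : ∀ i, a i ≠ 0) {f c t : F} (hf : f ≠ 0) (hc : a 0 * a 1 * a 2 * a 3 * c ^ 2 = f)
    (h : galoisSymbol h2 (-(a 0 * a 1)) (-(a 0 * a 2)) = galoisSymbol h2 f t) :
    IsotropicDiag a := by
  have h0 := ha 0
  have h1 := ha 1
  have h2' := ha 2
  have hc0 : c ≠ 0 := by
    rintro rfl
    simp [hf.symm] at hc
  obtain ⟨x₀, x₁, x₂, x₃, hx, hzero⟩ := isotropic_of_galoisSymbol_eq h2
    (neg_ne_zero.2 (mul_ne_zero h0 h1)) (neg_ne_zero.2 (mul_ne_zero h0 h2')) hf h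
  refine ⟨![x₀ / a 0, x₁, x₂, a 0 * a 1 * a 2 * c * x₃], fun hy => ?_, ?_⟩
  · have hy' : ∀ i, ![x₀ / a 0, x₁, x₂, a 0 * a 1 * a 2 * c * x₃] i = 0 := fun i => by rw [hy]; rfl
    have e0 : x₀ / a 0 = 0 := hy' 0
    have e1 : x₁ = 0 := hy' 1
    have e2 : x₂ = 0 := hy' 2
    have e3 : a 0 * a 1 * a 2 * c * x₃ = 0 := hy' 3
    simp only [div_eq_zero_iff, mul_eq_zero, h0, h1, h2', hc0, or_false, false_or] at e0 e3
    tauto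
  · have hs : a 0 * (x₀ / a 0) ^ 2 + a 1 * x₁ ^ 2 + a 2 * x₂ ^ 2 +
        a 3 * (a 0 * a 1 * a 2 * c * x₃) ^ 2 = 0 := by
      field_simp
      linear_combination hzero + a 0 ^ 2 * a 1 * a 2 * x₃ ^ 2 * hc
    rw [Fin.sum_univ_four]
    exact hs

lemma IsotropicDiag.of_mul_sq {F : Type*} [Field F] {n : ℕ} {a d : Fin n → F} (hd : ∀ i, d i ≠ 0)
    (h : IsotropicDiag fun i => a i * d i ^ 2) : IsotropicDiag a := by
  obtain ⟨x, hx, hsum⟩ := h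
  refine ⟨fun i => d i * x i, fun h0 => hx (funext fun i => ?_), ?_⟩
  · exact (mul_eq_zero.1 (congrFun h0 i)).resolve_left (hd i)
  · rw [← hsum]
    exact Finset.sum_congr rfl fun i _ => by ring

/-- If every 3-dimensional regular quadratic form over `E` is isotropic and
`f ∈ E[X]` is square-reflexive, then 4-dimensional quadratic forms over `E(X)` with
determinant class `f·(E(X)^×)²` satisfy the local-global principle for isotropy with
respect to ℤ-valuations trivial on `E`. -/
theorem statement3 (E : Type*) [Field E] (hchar : ringChar E ≠ 2)
    (hu : ∀ b : Fin 3 → E, (∀ i, b i ≠ 0) → IsotropicDiag b)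
    (f : Polynomial E) (hf : IsSquareReflexive f)
    (a : Fin 4 → RatFunc E) (ha : ∀ i, a i ≠ 0)
    (hdet : ∃ u : (RatFunc E)ˣ,
      a 0 * a 1 * a 2 * a 3 = algebraMap (Polynomial E) (RatFunc E) f * (u : RatFunc E) ^ 2)
    (hloc : ∀ v : Valuation (RatFunc E) (WithZero (Multiplicative ℤ)),
      IsZValuationTrivialOnBase E v → IsotropicCompletion v a) :
    IsotropicDiag a := by
  obtain ⟨u, hdet⟩ := hdet
  have hinj := IsFractionRing.injective E[X] (RatFunc E)
  have hne : ∀ {w : E[X]}, w ≠ 0 → algebraMap E[X] (RatFunc E) w ≠ 0 :=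
    fun hw => (map_ne_zero_iff _ hinj).2 hw
  have h2 : (2 : RatFunc E) ≠ 0 := by
    have h := (map_ne_zero_iff (algebraMap E (RatFunc E)) (algebraMap E (RatFunc E)).injective).2
      (Ring.two_ne_zero hchar)
    rwa [map_ofNat] at h
  have hf0 : f ≠ 0 := hf.1.ne_zero
  obtain ⟨A, d, hA, hd, hAd⟩ : ∃ A d : Fin 4 → E[X], (∀ i, A i ≠ 0) ∧ (∀ i, d i ≠ 0) ∧
      ∀ i, a i * algebraMap E[X] (RatFunc E) (d i) ^ 2 = algebraMap E[X] (RatFunc E) (A i) := by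
    refine ⟨fun i => (a i).num * (a i).denom, fun i => (a i).denom,
      fun i => mul_ne_zero (RatFunc.num_ne_zero (ha i)) (a i).denom_ne_zero,
      fun i => (a i).denom_ne_zero, fun i => ?_⟩
    have h := RatFunc.num_div_denom (a i)
    have h0 := hne (a i).denom_ne_zero
    rw [div_eq_iff h0] at h
    rw [map_mul, h]
    ring
  set φ := algebraMap E[X] (RatFunc E) with hφ
  obtain ⟨m, n, hm, hn, hmn⟩ : ∃ m n : E[X], m ≠ 0 ∧ n ≠ 0 ∧
      A 0 * A 1 * A 2 * A 3 * m ^ 2 = f * n ^ 2 := by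
    set w := (u : RatFunc E) * φ (d 0 * d 1 * d 2 * d 3) with hw
    have hw0 : w ≠ 0 := mul_ne_zero u.ne_zero
      (hne (mul_ne_zero (mul_ne_zero (mul_ne_zero (hd 0) (hd 1)) (hd 2)) (hd 3)))
    refine ⟨w.denom, w.num, w.denom_ne_zero, RatFunc.num_ne_zero hw0, hinj ?_⟩
    have h := RatFunc.num_div_denom w
    rw [← hφ, div_eq_iff (hne w.denom_ne_zero)] at h
    simp only [map_mul, map_pow] at hw ⊢
    rw [h, ← hAd 0, ← hAd 1, ← hAd 2, ← hAd 3]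
    generalize φ w.denom = e
    rw [hw]
    linear_combination (φ (d 0) * φ (d 1) * φ (d 2) * φ (d 3) * e) ^ 2 * hdet
  have hAA : A 0 * A 1 * A 2 * A 3 ≠ 0 :=
    mul_ne_zero (mul_ne_zero (mul_ne_zero (hA 0) (hA 1)) (hA 2)) (hA 3)
  have hlocal : ∀ {k : Type _} [Field k] (D : AngularData E[X] k),
      (∃ v : Valuation (RatFunc E) (WithZero (Multiplicative ℤ)), IsZValuationTrivialOnBase E v ∧
        ∀ u w : E[X], w ≠ 0 → v (φ u) < v (φ w) → u = 0 ∨ D.v w < D.v u) →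
      ∃ t, t ≠ 0 ∧ D.tame (-(A 0 * A 1)) (-(A 0 * A 2)) = D.tame f t := by
    rintro k _ D ⟨v, hv, hvD⟩
    obtain ⟨t, ht, h⟩ := exists_tame_eq_of_isotropicCompletion D hvD hA hd hAd (hloc v hv)
    have hE : D.TameEquiv (A 0 * A 1 * A 2 * A 3) (f * n ^ 2) :=
      hmn ▸ AngularData.TameEquiv.of_mul_sq hAA hm
    replace hE := hE.trans (AngularData.TameEquiv.of_mul_sq hf0 hn).symm
    exact ⟨t, ht, h.trans (hE.2.2 t ht)⟩
  have ha₁ : -(A 0 * A 1) ≠ 0 := neg_ne_zero.2 (mul_ne_zero (hA 0) (hA 1))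
  have hb₁ : -(A 0 * A 2) ≠ 0 := neg_ne_zero.2 (mul_ne_zero (hA 0) (hA 2))
  obtain ⟨t, ht, hsym⟩ := ((galoisSymbol h2).comap φ hinj).exists_eq_of_tame_eq hf hu ha₁ hb₁
    (fun p => hlocal _ (exists_valuation_adic p)) (hlocal _ exists_valuation_degree)
  refine IsotropicDiag.of_mul_sq (fun i => hne (hd i)) ?_
  simp only [hAd]
  refine isotropicDiag_of_symbol_eq h2 (fun i => hne (hA i)) (c := φ m / φ n) (t := φ t) (hne hf0)
    ?_ ?_
  · have hn' := hne hn
    rw [div_pow, ← mul_div_assoc, div_eq_iff (pow_ne_zero _ hn')]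
    simpa only [map_mul, map_pow] using congrArg φ hmn
  · have h : galoisSymbol h2 (φ (-(A 0 * A 1))) (φ (-(A 0 * A 2))) =
        galoisSymbol h2 (φ f) (φ t) := hsym
    simpa only [map_neg, map_mul] using h
end

section
/- Let E be a field of characteristic different from 2 with E^× = (E^×)², i.e., every nonzero element of E is a square. Let f ∈ E[X] be a square-free polynomial such that f = p·q where p, q ∈ E[X], deg p ≤ 5, and q splits into linear factors over E. Then f is square-reflexive. -/
open Polynomial

section SquareReflexive

variable {E : Type*} [Field E]

theorem Polynomial.isCoprime_X_sub_C_iff {p : E[X]} {a : E} :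
    IsCoprime p (X - C a) ↔ p.eval a ≠ 0 := by
  rw [isCoprime_comm, (irreducible_X_sub_C a).coprime_iff_not_dvd, dvd_iff_isRoot, IsRoot.def]

theorem Polynomial.isUnit_mk_of_isCoprime {p g : E[X]} (h : IsCoprime p g) :
    IsUnit (Ideal.Quotient.mk (Ideal.span {p}) g) := by
  obtain ⟨u, v, huv⟩ := h
  refine .of_mul_eq_one (Ideal.Quotient.mk _ v) ?_
  rw [← map_mul, ← map_one (Ideal.Quotient.mk (Ideal.span {p})), Ideal.Quotient.mk_eq_mk_iff_sub_mem,
    Ideal.mem_span_singleton]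
  exact ⟨-u, by linear_combination huv⟩

theorem Polynomial.isCoprime_of_isUnit_mk {p g : E[X]}
    (h : IsUnit (Ideal.Quotient.mk (Ideal.span {p}) g)) : IsCoprime p g := by
  obtain ⟨v, hv⟩ := h.exists_right_inv
  obtain ⟨v, rfl⟩ := Ideal.Quotient.mk_surjective v
  rw [← map_mul, ← map_one (Ideal.Quotient.mk (Ideal.span {p})), Ideal.Quotient.mk_eq_mk_iff_sub_mem,
    Ideal.mem_span_singleton] at hv
  obtain ⟨u, hu⟩ := hv
  exact ⟨-u, v, by linear_combination hu⟩

theorem Polynomial.nodup_roots_of_squarefree {f : E[X]} (hf : Squarefree f) : f.roots.Nodup := by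
  classical
  rw [Multiset.nodup_iff_count_le_one]
  intro a
  rw [count_roots]
  by_contra! h
  have h2 : (X - C a) ^ 2 ∣ f := (le_rootMultiplicity_iff hf.ne_zero).1 h
  rw [pow_two] at h2
  exact (irreducible_X_sub_C a).not_isUnit (hf _ h2)

/-- Chinese remainder theorem for being a square modulo coprime elements. -/
theorem IsCoprime.exists_mul_dvd_sub_sq {R : Type*} [CommRing R] {m n h : R} (hmn : IsCoprime m n)
    (hm : ∃ t, m ∣ h - t ^ 2) (hn : ∃ t, n ∣ h - t ^ 2) : ∃ t, m * n ∣ h - t ^ 2 := by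
  obtain ⟨s, hs⟩ := hm
  obtain ⟨t, ht⟩ := hn
  obtain ⟨u, v, huv⟩ := id hmn
  refine ⟨s * (v * n) + t * (u * m), hmn.mul_dvd ?_ ?_⟩
  · have : h - (s * (v * n) + t * (u * m)) ^ 2 = (h - s ^ 2) +
        m * (u * (s - t) * (s + (s * (v * n) + t * (u * m)))) := by
      linear_combination (s * (s + (s * (v * n) + t * (u * m)))) * (-huv)
    rw [this]
    exact dvd_add hs (dvd_mul_right _ _)
  · have : h - (s * (v * n) + t * (u * m)) ^ 2 = (h - t ^ 2) +
        n * (v * (t - s) * (t + (s * (v * n) + t * (u * m)))) := by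
      linear_combination (t * (t + (s * (v * n) + t * (u * m)))) * (-huv)
    rw [this]
    exact dvd_add ht (dvd_mul_right _ _)

theorem Polynomial.exists_prod_X_sub_C_dvd_sub_sq (hqc : ∀ a : E, a ≠ 0 → IsSquare a)
    (T : Finset E) (h : E[X]) : ∃ t, ∏ a ∈ T, (X - C a) ∣ h - t ^ 2 := by
  classical
  induction T using Finset.induction_on with
  | empty => simp
  | insert a T ha ih =>
    rw [Finset.prod_insert ha]
    refine IsCoprime.exists_mul_dvd_sub_sq ?_ ?_ ih
    · refine IsCoprime.prod_right fun b hb ↦ ?_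
      rw [isCoprime_X_sub_C_iff]
      simpa [sub_eq_zero] using fun h : b = a ↦ ha (h ▸ hb)
    · obtain ⟨s, hs⟩ : IsSquare (h.eval a) := by
        by_cases h0 : h.eval a = 0
        · exact ⟨0, by simp [h0]⟩
        · exact hqc _ h0
      exact ⟨C s, by simp [dvd_iff_isRoot, hs, pow_two]⟩

theorem Polynomial.splits_of_natDegree_le_two_of_isSquare (hqc : ∀ a : E, a ≠ 0 → IsSquare a)
    (h2 : (2 : E) ≠ 0) {w : E[X]} (hw : w.natDegree ≤ 2) : w.Splits := by
  rcases hw.lt_or_eq with hw | hw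
  · exact Splits.of_natDegree_le_one (by omega)
  · have : NeZero (2 : E) := ⟨h2⟩
    have ha : w.coeff 2 ≠ 0 := by
      rw [← hw]
      exact leadingCoeff_ne_zero.2 fun h ↦ by simp [h] at hw
    obtain ⟨x, hx⟩ := exists_quadratic_eq_zero (a := w.coeff 2) (b := w.coeff 1) (c := w.coeff 0) ha
      (by
        by_cases h0 : discrim (w.coeff 2) (w.coeff 1) (w.coeff 0) = 0
        · exact ⟨0, by simp [h0]⟩
        · exact hqc _ h0)
    refine Splits.of_natDegree_eq_two hw (x := x) ?_
    rw [eval_eq_sum_range, hw]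
    simp only [Finset.sum_range_succ, Finset.sum_range_zero]
    linear_combination hx

theorem infinite_of_forall_isSquare (hchar : ringChar E ≠ 2)
    (hqc : ∀ a : E, a ≠ 0 → IsSquare a) : Infinite E := by
  by_contra h
  rw [not_infinite_iff_finite] at h
  obtain ⟨a, ha⟩ := FiniteField.exists_nonsquare hchar
  by_cases h0 : a = 0
  · exact ha ⟨0, by simp [h0]⟩
  · exact ha (hqc _ h0)

theorem Polynomial.exists_eval_notMem [Infinite E] {p : E[X]} (hp : 0 < p.natDegree)
    (S : Finset E) : ∃ a, p.eval a ∉ S := by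
  have h0 : ∏ c ∈ S, (p - C c) ≠ 0 := by
    refine Finset.prod_ne_zero_iff.2 fun c _ h ↦ ?_
    rw [sub_eq_zero.1 h, natDegree_C] at hp
    exact hp.ne rfl
  by_contra! h
  refine h0 (Polynomial.funext fun a ↦ ?_)
  rw [eval_prod, eval_zero]
  exact Finset.prod_eq_zero (h a) (by simp)

/-- Up to the square of a unit, `x` is the image under `φ` of a product of distinct monic linear
polynomials whose roots avoid `B`. -/
def IsSplitModSquares {R : Type*} [CommRing R] (φ : E[X] →+* R) (B : Set E) (x : R) : Prop :=
  ∃ T : Finset E, (∀ a ∈ T, a ∉ B) ∧ ∃ t, IsUnit t ∧ x = φ (∏ a ∈ T, (X - C a)) * t ^ 2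

namespace IsSplitModSquares

variable {R : Type*} [CommRing R] {φ : E[X] →+* R} {B : Set E}

theorem of_sq {t : R} (ht : IsUnit t) : IsSplitModSquares φ B (t ^ 2) :=
  ⟨∅, by simp, t, ht, by simp⟩

theorem X_sub_C {a : E} (ha : a ∉ B) : IsSplitModSquares φ B (φ (X - C a)) :=
  ⟨{a}, by simpa using ha, 1, isUnit_one, by simp⟩

theorem mul (hφ : ∀ a, IsUnit (φ (X - C a))) {x y : R} (hx : IsSplitModSquares φ B x)
    (hy : IsSplitModSquares φ B y) : IsSplitModSquares φ B (x * y) := by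
  classical
  obtain ⟨T, hT, t, ht, rfl⟩ := hx
  obtain ⟨S, hS, s, hs, rfl⟩ := hy
  refine ⟨symmDiff T S, fun a ha ↦ ?_, φ (∏ a ∈ T ∩ S, (X - C a)) * t * s, ?_, ?_⟩
  · rcases Finset.mem_symmDiff.1 ha with h | h
    exacts [hT _ h.1, hS _ h.1]
  · refine (IsUnit.mul ?_ ht).mul hs
    rw [map_prod]
    exact IsUnit.prod_iff.2 fun a _ ↦ hφ a
  · have h1 : ∏ a ∈ T, (X - C a) = (∏ a ∈ T \ S, (X - C a)) * ∏ a ∈ T ∩ S, (X - C a) := by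
      rw [mul_comm, Finset.prod_inter_mul_prod_sdiff]
    have h2 : ∏ a ∈ S, (X - C a) = (∏ a ∈ S \ T, (X - C a)) * ∏ a ∈ T ∩ S, (X - C a) := by
      rw [mul_comm, Finset.inter_comm, Finset.prod_inter_mul_prod_sdiff]
    have h3 : ∏ a ∈ symmDiff T S, (X - C a) =
        (∏ a ∈ T \ S, (X - C a)) * ∏ a ∈ S \ T, (X - C a) := by
      rw [symmDiff_def, Finset.sup_eq_union, Finset.prod_union disjoint_sdiff_sdiff]
    rw [h1, h2, h3]
    simp only [map_mul]
    ring

theorem isUnit (hφ : ∀ a, IsUnit (φ (X - C a))) {x : R} (hx : IsSplitModSquares φ B x) :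
    IsUnit x := by
  obtain ⟨T, -, t, ht, rfl⟩ := hx
  refine IsUnit.mul ?_ (ht.pow 2)
  rw [map_prod]
  exact IsUnit.prod_iff.2 fun a _ ↦ hφ a

theorem of_mul_right (hφ : ∀ a, IsUnit (φ (X - C a))) {x y : R}
    (hxy : IsSplitModSquares φ B (x * y)) (hy : IsSplitModSquares φ B y) :
    IsSplitModSquares φ B x := by
  obtain ⟨z, hz⟩ := (hy.isUnit hφ).exists_right_inv
  have hzu : IsUnit z := .of_mul_eq_one y (by rw [mul_comm, hz])
  have : x = x * y * y * z ^ 2 := by linear_combination (-x * (1 + y * z)) * hz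
  rw [this]
  exact (hxy.mul hφ hy).mul hφ (of_sq hzu)

theorem of_splits (hφ : ∀ a, IsUnit (φ (X - C a))) (hqc : ∀ a : E, a ≠ 0 → IsSquare a)
    {w : E[X]} (hw : w.Splits) (hw0 : w ≠ 0)
    (hr : ∀ a, w.eval a = 0 → IsSplitModSquares φ B (φ (X - C a))) :
    IsSplitModSquares φ B (φ w) := by
  have key : ∀ s : Multiset E, (∀ a ∈ s, IsSplitModSquares φ B (φ (X - C a))) →
      IsSplitModSquares φ B (φ (s.map fun a ↦ X - C a).prod) := by
    intro s
    induction s using Multiset.induction_on with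
    | empty => exact fun _ ↦ by simpa using of_sq (φ := φ) (B := B) isUnit_one
    | cons a s ih =>
      intro h
      rw [Multiset.map_cons, Multiset.prod_cons, map_mul]
      exact (h a (by simp)).mul hφ (ih fun b hb ↦ h b (by simp [hb]))
  obtain ⟨d, hd⟩ := hqc _ (leadingCoeff_ne_zero.2 hw0)
  have hd0 : d ≠ 0 := by
    rintro rfl
    simp [hw0] at hd
  rw [hw.eq_prod_roots, map_mul, hd, ← pow_two, map_pow, map_pow]
  exact (of_sq (((isUnit_iff_ne_zero.2 hd0).map C).map φ)).mul hφ
    (key _ fun a ha ↦ hr a (by simpa [hw0] using ha))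

end IsSplitModSquares

/-- Padé approximation modulo a polynomial of degree at most `5`. -/
theorem Polynomial.exists_dvd_mul_sub_of_natDegree_le_five {p : E[X]} (hp0 : p ≠ 0)
    (hp5 : p.natDegree ≤ 5) (h : E[X]) :
    ∃ w v : E[X], w.degree < 3 ∧ v.degree < 3 ∧ (w ≠ 0 ∨ v ≠ 0) ∧ p ∣ h * w - v := by
  let F : (degreeLT E 3 × degreeLT E 3) →ₗ[E] (E[X] ⧸ Ideal.span {p}) :=
    (Ideal.Quotient.mkₐ E (Ideal.span {p})).toLinearMap ∘ₗ
      ((LinearMap.mulLeft E h ∘ₗ (degreeLT E 3).subtype).coprod (-(degreeLT E 3).subtype))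
  have : FiniteDimensional E (degreeLT E 3) := (degreeLTEquiv E 3).symm.finiteDimensional
  have : FiniteDimensional E (E[X] ⧸ Ideal.span {p}) :=
    (AdjoinRoot.powerBasis hp0).finite
  have hF : LinearMap.ker F ≠ ⊥ := by
    refine LinearMap.ker_ne_bot_of_finrank_lt ?_
    rw [finrank_quotient_span_eq_natDegree, Module.finrank_prod,
      (degreeLTEquiv E 3).finrank_eq, Module.finrank_fin_fun]
    omega
  obtain ⟨⟨⟨w, hw⟩, ⟨v, hv⟩⟩, hker, hne⟩ := (Submodule.ne_bot_iff _).1 hF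
  refine ⟨w, v, by simpa using mem_degreeLT.1 hw, by simpa using mem_degreeLT.1 hv, ?_, ?_⟩
  · by_contra! h0
    obtain ⟨rfl, rfl⟩ := h0
    exact hne rfl
  · have : F (⟨w, hw⟩, ⟨v, hv⟩) = Ideal.Quotient.mk (Ideal.span {p}) (h * w - v) := by
      simp [F, sub_eq_add_neg]
    rw [LinearMap.mem_ker, this, Ideal.Quotient.eq_zero_iff_mem, Ideal.mem_span_singleton] at hker
    exact hker

/-- For a polynomial `p` without roots and a finite set `B`, a generic division of `p` by a
multiple `(X - r) (X - b) (X - a)` of `X - r` has quotient and remainder without roots in `B`. -/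
theorem Polynomial.exists_eq_mul_add_of_finset [Infinite E] {p : E[X]}
    (hroot : ∀ a, p.eval a ≠ 0) (hp3 : 3 ≤ p.natDegree) (B : Finset E) {r : E} (hr : r ∈ B) :
    ∃ a b : E, a ∉ B ∧ b ∉ B ∧ ∃ w v : E[X], w.natDegree = p.natDegree - 3 ∧ v.natDegree ≤ 2 ∧
      p = (X - C r) * (X - C b) * (X - C a) * w + v ∧
      ∀ s ∈ B, w.eval s ≠ 0 ∧ v.eval s ≠ 0 := by
  classical
  have step (g : E[X]) (c : E) : g = C (g.eval c) + (X - C c) * (g /ₘ (X - C c)) := by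
    conv_lhs => rw [← modByMonic_add_div g (X - C c), modByMonic_X_sub_C_eq_C_eval]
  have deg (g : E[X]) (c : E) : (g /ₘ (X - C c)).natDegree = g.natDegree - 1 := by
    rw [natDegree_divByMonic _ (monic_X_sub_C c), natDegree_X_sub_C]
  obtain ⟨b, hb⟩ := Infinite.exists_notMem_finset B
  set p₁ := p /ₘ (X - C r) with hp₁
  set p₂ := p₁ /ₘ (X - C b) with hp₂
  obtain ⟨a, ha⟩ := exists_eval_notMem (p := p₂) (by rw [deg, deg]; omega)
    (B.image (fun s ↦ p₂.eval s) ∪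
      B.image (fun s ↦ (-p.eval r / (s - r) - p₁.eval b) / (s - b)))
  simp only [Finset.mem_union, Finset.mem_image, not_or, not_exists, not_and] at ha
  have h₀ := step p r
  have h₁ := step p₁ b
  have h₂ := step p₂ a
  rw [← hp₁] at h₀
  rw [← hp₂] at h₁
  set p₃ := p₂ /ₘ (X - C a) with hp₃
  refine ⟨a, b, fun h ↦ ha.1 a h rfl, hb, p₃,
    C (p.eval r) + (X - C r) * (C (p₁.eval b) + (X - C b) * C (p₂.eval a)), ?_, by compute_degree,
    ?_, fun s hs ↦ ⟨fun h ↦ ?_, fun h ↦ ?_⟩⟩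
  · rw [deg, deg, deg]
    omega
  · linear_combination h₀ + (X - C r) * h₁ + (X - C r) * (X - C b) * h₂
  · apply_fun eval s at h₂
    refine ha.1 s hs ?_
    simpa [h] using h₂
  · by_cases hsr : s = r
    · subst hsr
      simp [hroot] at h
    · have hsr' : s - r ≠ 0 := sub_ne_zero.2 hsr
      have hsb : s - b ≠ 0 := sub_ne_zero.2 fun h ↦ hb (h ▸ hs)
      refine ha.2 s hs ?_
      simp only [eval_add, eval_mul, eval_sub, eval_X, eval_C] at h
      field_simp
      linear_combination -h

theorem IsSplitModSquares.of_isUnit (hchar : ringChar E ≠ 2)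
    (hqc : ∀ a : E, a ≠ 0 → IsSquare a) {p : E[X]} (hroot : ∀ a, p.eval a ≠ 0)
    (hp5 : p.natDegree ≤ 5) (B : Finset E) {h : E[X]}
    (hh : IsUnit (Ideal.Quotient.mk (Ideal.span {p}) h)) :
    IsSplitModSquares (Ideal.Quotient.mk (Ideal.span {p})) (B : Set E)
      (Ideal.Quotient.mk (Ideal.span {p}) h) := by
  have h2 : (2 : E) ≠ 0 := Ring.two_ne_zero hchar
  have hinf : Infinite E := infinite_of_forall_isSquare hchar hqc
  have hp0 : p ≠ 0 := by
    rintro rfl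
    exact hroot 0 eval_zero
  set φ := Ideal.Quotient.mk (Ideal.span {p})
  have hdvd {x y : E[X]} (h : p ∣ x - y) : φ x = φ y := by
    rwa [Ideal.Quotient.mk_eq_mk_iff_sub_mem, Ideal.mem_span_singleton]
  have hφ (a : E) : IsUnit (φ (X - C a)) :=
    isUnit_mk_of_isCoprime (isCoprime_X_sub_C_iff.2 (hroot a))
  rcases lt_or_ge p.natDegree 3 with hp3 | hp3
  · have hu : IsUnit p := by
      rw [isUnit_iff_degree_eq_zero]
      by_contra hd
      obtain ⟨a, ha⟩ := (splits_of_natDegree_le_two_of_isSquare hqc h2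
        (Nat.le_of_lt_succ hp3)).exists_eval_eq_zero hd
      exact hroot a ha
    have h1 : φ h = 1 ^ 2 := by
      rw [one_pow, ← map_one φ]
      exact hdvd (hu.dvd)
    rw [h1]
    exact of_sq isUnit_one
  have hlin (r : E) : IsSplitModSquares φ (B : Set E) (φ (X - C r)) := by
    by_cases hr : r ∈ B
    · obtain ⟨a, b, ha, hb, w, v, hw, hv, hpe, hB⟩ := exists_eq_mul_add_of_finset hroot hp3 B hr
      have good {g : E[X]} (hg : g.natDegree ≤ 2) (hgB : ∀ s ∈ B, g.eval s ≠ 0) :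
          IsSplitModSquares φ (B : Set E) (φ g) := by
        refine of_splits hφ hqc (splits_of_natDegree_le_two_of_isSquare hqc h2 hg) ?_ ?_
        · rintro rfl
          exact hgB r hr eval_zero
        · exact fun s hs ↦ X_sub_C fun hsB ↦ hgB s hsB hs
      have heq : φ (X - C r) * (φ (X - C b) * φ (X - C a) * φ w) = φ (-v) := by
        simp only [← map_mul]
        exact hdvd ⟨1, by linear_combination -hpe⟩
      refine of_mul_right hφ ?_ (((X_sub_C hb).mul hφ (X_sub_C ha)).mul hφ
        (good (by omega) fun s hs ↦ (hB s hs).1))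
      rw [heq]
      exact good (by simpa using hv) fun s hs ↦ by simpa using (hB s hs).2
    · exact X_sub_C hr
  obtain ⟨w, v, hw, hv, hne, hwv⟩ := exists_dvd_mul_sub_of_natDegree_le_five hp0 hp5 h
  have hsmall {g : E[X]} (hg : g.degree < 3) (hpg : p ∣ g) : g = 0 := by
    refine eq_zero_of_dvd_of_degree_lt hpg (hg.trans_le ?_)
    rw [degree_eq_natDegree hp0]
    exact_mod_cast hp3
  have hw0 : w ≠ 0 := by
    rintro rfl
    simp only [mul_zero, zero_sub, dvd_neg] at hwv
    simp [hsmall hv hwv] at hne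
  have hv0 : v ≠ 0 := by
    rintro rfl
    rw [sub_zero] at hwv
    exact hw0 (hsmall hw ((isCoprime_of_isUnit_mk hh).dvd_of_dvd_mul_left hwv))
  have good {g : E[X]} (hg : g.degree < 3) (hg0 : g ≠ 0) :
      IsSplitModSquares φ (B : Set E) (φ g) := by
    refine of_splits hφ hqc (splits_of_natDegree_le_two_of_isSquare hqc h2 ?_) hg0
      fun s _ ↦ hlin s
    exact Nat.le_of_lt_succ ((natDegree_lt_iff_degree_lt hg0).2 (by exact_mod_cast hg))
  refine of_mul_right hφ ?_ (good hw hw0)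
  rw [← map_mul, hdvd hwv]
  exact good hv hv0

theorem isSquareReflexive_of_rootless_mul_prod (hchar : ringChar E ≠ 2)
    (hqc : ∀ a : E, a ≠ 0 → IsSquare a) {p : E[X]} (hroot : ∀ a, p.eval a ≠ 0)
    (hp5 : p.natDegree ≤ 5) (B : Finset E) (hf : Squarefree (p * ∏ a ∈ B, (X - C a))) :
    IsSquareReflexive (p * ∏ a ∈ B, (X - C a)) := by
  set f := p * ∏ a ∈ B, (X - C a) with hfdef
  refine ⟨hf, fun α _ ↦ ?_⟩
  obtain ⟨h, hh⟩ := Ideal.Quotient.mk_surjective (α : E[X] ⧸ Ideal.span {f})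
  have hfh : IsCoprime f h := isCoprime_of_isUnit_mk (hh ▸ α.isUnit)
  obtain ⟨T, hT, t, -, ht⟩ := IsSplitModSquares.of_isUnit hchar hqc hroot hp5 B
    (isUnit_mk_of_isCoprime (hfh.of_mul_left_left))
  obtain ⟨t, rfl⟩ := Ideal.Quotient.mk_surjective t
  set g := ∏ a ∈ T, (X - C a)
  have hfg : IsCoprime f g := by
    refine IsCoprime.prod_right fun a ha ↦ isCoprime_X_sub_C_iff.2 ?_
    rw [hfdef, eval_mul, eval_prod]
    refine mul_ne_zero (hroot a) (Finset.prod_ne_zero_iff.2 fun b hb ↦ ?_)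
    simpa [sub_eq_zero] using fun hab : a = b ↦ hT a ha (hab ▸ hb)
  obtain ⟨s, hs⟩ : ∃ s, f ∣ h * g - s ^ 2 := by
    refine IsCoprime.exists_mul_dvd_sub_sq
      (IsCoprime.prod_right fun a _ ↦ isCoprime_X_sub_C_iff.2 (hroot a)) ⟨g * t, ?_⟩
      (exists_prod_X_sub_C_dvd_sub_sq hqc B _)
    rw [← Ideal.mem_span_singleton, ← Ideal.Quotient.mk_eq_mk_iff_sub_mem, map_mul, ht]
    simp only [map_mul, map_pow]
    ring
  rw [← Ideal.mem_span_singleton, ← Ideal.Quotient.mk_eq_mk_iff_sub_mem, map_mul, hh,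
    map_pow] at hs
  have hsu : IsUnit (Ideal.Quotient.mk (Ideal.span {f}) s) := by
    rw [← isUnit_pow_iff two_ne_zero, ← hs]
    exact α.isUnit.mul (isUnit_mk_of_isCoprime hfg)
  obtain ⟨σ, hσ⟩ := hsu
  refine ⟨g, hfg, ⟨α⁻¹ * σ, ?_⟩, ?_⟩
  · rw [Units.val_mul, mul_pow, hσ, ← hs]
    linear_combination (-(1 + (α : E[X] ⧸ Ideal.span {f}) * ↑α⁻¹) *
      Ideal.Quotient.mk (Ideal.span {f}) g) * α.mul_inv
  · obtain ⟨u, hu⟩ := exists_prod_X_sub_C_dvd_sub_sq hqc T f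
    rw [← Ideal.mem_span_singleton, ← Ideal.Quotient.mk_eq_mk_iff_sub_mem] at hu
    exact ⟨Ideal.Quotient.mk _ u, by rw [hu, map_pow, pow_two]⟩

end SquareReflexive

/-- Over a quadratically closed field `E`, a square-free polynomial `f = p·q` with
`deg p ≤ 5` and `q` split is square-reflexive. -/
theorem statement11 (E : Type*) [Field E] (hchar : ringChar E ≠ 2)
    (hqc : ∀ a : E, a ≠ 0 → IsSquare a)
    (f p q : Polynomial E) (hf : Squarefree f) (hfactor : f = p * q)
    (hp : p.natDegree ≤ 5) (hq : (q.map (RingHom.id E)).Splits) :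
    IsSquareReflexive f := by
  classical
  obtain ⟨p', hp', hdeg, hroots⟩ := exists_prod_multiset_X_sub_C_mul f
  have hf0 := hf.ne_zero
  have hp'0 : p' ≠ 0 := by
    rintro rfl
    exact hf0 (by rw [← hp', mul_zero])
  have hpq : p * q ≠ 0 := hfactor ▸ hf0
  have hle : p'.natDegree ≤ 5 := by
    have hqr : q.natDegree = q.roots.card := by
      rw [map_id] at hq
      exact hq.natDegree_eq_card_roots
    have h1 : f.natDegree = p.natDegree + q.natDegree := by
      rw [hfactor, natDegree_mul (left_ne_zero_of_mul hpq) (right_ne_zero_of_mul hpq)]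
    have h2 : q.roots.card ≤ f.roots.card := by
      rw [hfactor, roots_mul hpq, Multiset.card_add]
      exact Nat.le_add_left _ _
    omega
  have hfe : f = p' * ∏ a ∈ f.roots.toFinset, (X - C a) := by
    rw [Finset.prod, Multiset.toFinset_val, (nodup_roots_of_squarefree hf).dedup, mul_comm, hp']
  rw [hfe] at hf ⊢
  refine isSquareReflexive_of_rootless_mul_prod hchar hqc (fun a ha ↦ ?_) hle _ hf
  have : a ∈ p'.roots := (mem_roots hp'0).2 ha
  simp [hroots] at this
end
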